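/- Let H_n be the height of a random admissible walk of length n on ℕ₀, i.e. E H_n = (Σ_{h≥0} h·V(n,h))/(Σ_{h≥0} V(n,h)). Then, as n → ∞, E H_n = 2G√(2n/π) − 1 + (5√2 G)/(6√(πn)) − (131√2 G)/(720√(πn³)) + (1129√2 G)/(12096√(πn⁵)) + O(n^{−7/2}), where G = Σ_{k≥0} (−1)^k/(2k+1)² is the Catalan constant. -/

import Mathlib

open Real

/-- Partial sum `S_k` of the `±1`-walk encoded by `ε : Fin n → Bool`
(`true` = step `+1`, `false` = step `-1`). -/
def walkSum (n : ℕ) (ε : Fin n → Bool) (k : ℕ) : ℤ :=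
  ∑ i : Fin n, if (i : ℕ) < k then (if ε i then 1 else -1) else 0

/-- `V n h`: number of `±1`-paths of length `n` with `|S_k| ≤ h` for all `k` and `|S_n| = h`. -/
noncomputable def V (n h : ℕ) : ℕ :=
  Nat.card {ε : Fin n → Bool //
    (∀ k ≤ n, |walkSum n ε k| ≤ (h : ℤ)) ∧ |walkSum n ε n| = (h : ℤ)}

/-- Expected height `E H_n = (Σ_h h·V(n,h))/(Σ_h V(n,h))` of a random admissible walk on `ℕ₀`. -/
noncomputable def expHeight (n : ℕ) : ℝ :=
  (∑' h : ℕ, (h : ℝ) * (V n h : ℝ)) / (∑' h : ℕ, (V n h : ℝ))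

/-- The Catalan constant `G = Σ_{k≥0} (−1)^k/(2k+1)²`. -/
noncomputable def catalanG : ℝ := ∑' k : ℕ, (-1 : ℝ) ^ k / (2 * (k : ℝ) + 1) ^ 2

section Part1
open Real

lemma walkSum_cons_succ (n : ℕ) (b : Bool) (ε : Fin n → Bool) (k : ℕ) :
    walkSum (n+1) (Fin.cons b ε) (k+1) = (if b then 1 else -1) + walkSum n ε k := by
  unfold walkSum
  rw [Fin.sum_univ_succ]
  simp

lemma walkSum_zero (n : ℕ) (ε : Fin n → Bool) : walkSum n ε 0 = 0 := by
  simp [walkSum]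

lemma walkSum_not (n : ℕ) (ε : Fin n → Bool) (k : ℕ) :
    walkSum n (fun i => !ε i) k = - walkSum n ε k := by
  unfold walkSum
  rw [← Finset.sum_neg_distrib]
  apply Finset.sum_congr rfl
  intro i _
  by_cases h : (i:ℕ) < k <;> rcases hb : ε i <;> simp [h, hb]

/-- Sum of `f (z + S_n)` over all walks. -/
def wsum (f : ℤ → ℤ) (n : ℕ) (z : ℤ) : ℤ := ∑ ε : Fin n → Bool, f (z + walkSum n ε n)

lemma sum_cons {β : Type*} [AddCommMonoid β] (n : ℕ) (F : (Fin (n+1) → Bool) → β) :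
    ∑ ε, F ε = ∑ ε : Fin n → Bool, F (Fin.cons true ε) + ∑ ε : Fin n → Bool, F (Fin.cons false ε) := by
  rw [← (Fin.consEquiv (fun _ : Fin (n+1) => Bool)).sum_comp, Fintype.sum_prod_type]
  simp [Fin.consEquiv]

lemma wsum_succ (f : ℤ → ℤ) (n : ℕ) (z : ℤ) :
    wsum f (n+1) z = wsum f n (z+1) + wsum f n (z-1) := by
  unfold wsum
  rw [sum_cons]
  congr 1 <;> apply Finset.sum_congr rfl <;> intro ε _ <;> rw [walkSum_cons_succ] <;> congr 1 <;>
    simp <;> ring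

lemma wsum_choose (f : ℤ → ℤ) (n : ℕ) (z : ℤ) :
    wsum f n z = ∑ j ∈ Finset.range (n+1), (n.choose j : ℤ) * f (z + 2 * j - n) := by
  induction n generalizing z with
  | zero => simp [wsum, walkSum]
  | succ n ih =>
    rw [wsum_succ, ih, ih, Finset.sum_range_succ' _ (n+1)]
    simp only [Nat.choose_succ_succ, Nat.cast_add, add_mul, Finset.sum_add_distrib]
    rw [add_assoc]
    congr 1
    · apply Finset.sum_congr rfl
      intro j _
      congr 2; push_cast; ring
    · rw [Finset.sum_range_succ (fun x => ((n.choose (x+1) : ℕ) : ℤ) * _) n, Nat.choose_succ_self,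
        Finset.sum_range_succ' _ n]
      simp only [Nat.cast_zero, zero_mul, add_zero]
      congr 1
      · apply Finset.sum_congr rfl
        intro j _
        congr 2; push_cast; ring
      · simp; congr 1; ring

open Classical in
/-- Number of walks from `z` to `h` inside `[-h,h]`. -/
noncomputable def U (h : ℕ) (n : ℕ) (z : ℤ) : ℤ :=
  ∑ ε : Fin n → Bool, if ((∀ k ≤ n, |z + walkSum n ε k| ≤ (h : ℤ)) ∧ z + walkSum n ε n = h) then 1 else 0

lemma U_out (h n : ℕ) (z : ℤ) (hz : (h:ℤ) < |z|) : U h n z = 0 := by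
  unfold U
  apply Finset.sum_eq_zero
  intro ε _
  rw [if_neg]
  rintro ⟨h1, _⟩
  have := h1 0 (Nat.zero_le _)
  rw [walkSum_zero, add_zero] at this
  omega

lemma U_succ (h n : ℕ) (z : ℤ) (hz : |z| ≤ h) : U h (n+1) z = U h n (z+1) + U h n (z-1) := by
  unfold U
  rw [sum_cons]
  have key : ∀ (b : Bool) (ε : Fin n → Bool),
    ((∀ k ≤ n+1, |z + walkSum (n+1) (Fin.cons b ε) k| ≤ (h : ℤ)) ∧ z + walkSum (n+1) (Fin.cons b ε) (n+1) = h)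
     ↔ ((∀ k ≤ n, |(z + (if b then 1 else -1)) + walkSum n ε k| ≤ (h : ℤ)) ∧ (z + (if b then 1 else -1)) + walkSum n ε n = h) := by
    intro b ε
    rw [walkSum_cons_succ, add_assoc]
    apply and_congr_left
    intro _
    constructor
    · intro H k hk
      have := H (k+1) (by omega)
      rwa [walkSum_cons_succ, ← add_assoc] at this
    · intro H k hk
      cases k with
      | zero => simpa [walkSum_zero] using hz
      | succ k =>
        rw [walkSum_cons_succ, ← add_assoc]
        exact H k (by omega)
  simp only [key]
  simp [sub_eq_add_neg]

/-- indicator of `h+1 mod 4(h+1)` -/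
def eInd (h : ℕ) (x : ℤ) : ℤ := if (4 * ((h:ℤ)+1)) ∣ (x - (h+1)) then 1 else 0

def rInd (h : ℕ) (x : ℤ) : ℤ := eInd h (x+1) - eInd h (x-1)

lemma rInd_refl1 (h : ℕ) (x : ℤ) : rInd h (2*(h+1) - x) = - rInd h x := by
  have e1 : eInd h (2*(h+1) - x + 1) = eInd h (x - 1) := by
    unfold eInd
    congr 1
    rw [eq_iff_iff, ← dvd_neg]
    ring_nf
  have e2 : eInd h (2*(h+1) - x - 1) = eInd h (x + 1) := by
    unfold eInd
    congr 1
    rw [eq_iff_iff, ← dvd_neg]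
    ring_nf
  unfold rInd
  rw [e1, e2]; ring

lemma eInd_period (h : ℕ) (x : ℤ) : eInd h (x - 4 * (h+1)) = eInd h x := by
  unfold eInd
  congr 1
  rw [eq_iff_iff, show x - 4 * ((h:ℤ)+1) - (h+1) = (x - (h+1)) - 4 * ((h:ℤ)+1) by ring, dvd_sub_self_right]

lemma rInd_refl2 (h : ℕ) (x : ℤ) : rInd h (-2*(h+1) - x) = - rInd h x := by
  rw [← rInd_refl1]
  unfold rInd
  rw [← eInd_period h (2*(h+1) - x + 1), ← eInd_period h (2*(h+1) - x - 1)]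
  congr 2 <;> ring

lemma wsum_refl (f : ℤ → ℤ) (n : ℕ) (z : ℤ) (hf : ∀ x, f (2 * z - x) = - f x) : wsum f n z = 0 := by
  have : wsum f n z = - wsum f n z := by
    unfold wsum
    rw [← Finset.sum_neg_distrib]
    rw [← (Equiv.piCongrRight (fun _ : Fin n => Equiv.boolNot)).sum_comp]
    apply Finset.sum_congr rfl
    intro ε _
    rw [← hf]
    congr 1
    have := walkSum_not n ε n
    have e : ((Equiv.piCongrRight fun x : Fin n => Equiv.boolNot) ε) = fun i => ! ε i := by
      ext i; simp
    rw [e, this]; ring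
  omega

lemma U_eq (h n : ℕ) (z : ℤ) (hz : |z| ≤ h) : U h n z = wsum (rInd h) n z := by
  induction n generalizing z with
  | zero =>
    have hz' := abs_le.mp hz
    have : rInd h z = if z = h then 1 else 0 := by
      unfold rInd eInd
      have h1 : ¬ (4 * ((h:ℤ)+1)) ∣ (z - 1 - (h+1)) := by
        intro hd
        have := Int.eq_zero_of_abs_lt_dvd hd (by rw [abs_lt]; constructor <;> linarith)
        linarith
      rw [if_neg h1]
      by_cases hh : z = h
      · simp [hh]
      · rw [if_neg, if_neg hh]; · simp
        intro hd
        have := Int.eq_zero_of_abs_lt_dvd hd (by rw [abs_lt]; constructor <;> linarith)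
        apply hh; linarith
    simp [U, wsum, walkSum, this, hz]
  | succ n ih =>
    rw [U_succ h n z hz, wsum_succ]
    have key : ∀ w : ℤ, |w| ≤ h + 1 → U h n w = wsum (rInd h) n w := by
      intro w hw
      rcases le_or_gt (|w|) h with h1 | h1
      · exact ih w h1
      · rw [U_out h n w h1, wsum_refl]
        intro x
        have : |w| = h+1 := by omega
        rcases (abs_eq (by omega)).mp this with h2 | h2
        · rw [h2]; exact rInd_refl1 h x
        · rw [h2, ← rInd_refl2]; congr 1
    rw [abs_le] at hz
    rw [key (z+1) (by rw [abs_le]; omega), key (z-1) (by rw [abs_le]; omega)]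

lemma V_eq_U (n h : ℕ) (hn : 1 ≤ n) : (V n h : ℤ) = 2 * U h n 0 := by
  classical
  unfold V
  rw [Nat.card_eq_fintype_card, Fintype.card_subtype]
  rw [Finset.card_filter]
  push_cast
  rcases Nat.eq_zero_or_pos h with h0 | h0
  · subst h0
    have key : ∀ ε : Fin n → Bool, ¬ (∀ k ≤ n, |walkSum n ε k| ≤ ((0:ℕ) : ℤ)) := by
      intro ε H
      have h1 := H 1 hn
      obtain ⟨m, rfl⟩ : ∃ m, n = m + 1 := ⟨n-1, by omega⟩
      have h2 := walkSum_cons_succ m (ε 0) (Fin.tail ε) 0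
      rw [Fin.cons_self_tail, walkSum_zero] at h2
      rw [h2] at h1
      revert h1
      cases ε 0 <;> simp
    have : U 0 n 0 = 0 := by
      unfold U
      apply Finset.sum_eq_zero
      intro ε _
      rw [if_neg]
      rintro ⟨h1, _⟩
      apply key ε
      simpa using h1
    rw [this]
    simp only [mul_zero]
    apply Finset.sum_eq_zero
    intro ε _
    rw [if_neg]
    rintro ⟨h1, _⟩
    exact key ε h1
  · rw [two_mul]
    have e2 : U h n 0 = ∑ ε : Fin n → Bool, if ((∀ k ≤ n, |walkSum n ε k| ≤ (h : ℤ)) ∧ walkSum n ε n = -h) then 1 else 0 := by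
      unfold U
      rw [← (Equiv.piCongrRight (fun _ : Fin n => Equiv.boolNot)).sum_comp]
      apply Finset.sum_congr rfl
      intro ε _
      have e : ((Equiv.piCongrRight fun x : Fin n => Equiv.boolNot) ε) = fun i => ! ε i := by
        ext i; simp
      simp only [e, walkSum_not, zero_add, abs_neg, neg_eq_iff_eq_neg]
    nth_rewrite 1 [e2]
    unfold U
    rw [← Finset.sum_add_distrib]
    apply Finset.sum_congr rfl
    intro ε _
    simp only [zero_add]
    by_cases hA : ∀ k ≤ n, |walkSum n ε k| ≤ (h : ℤ)
    · simp only [and_iff_right hA]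
      simp only [abs_eq (Int.natCast_nonneg h)]
      by_cases h1 : walkSum n ε n = h
      · rw [h1]; simp; omega
      · simp [h1]
    · simp [hA]

/-- Number of unrestricted walks of length `M` ending at `x`. -/
def binN (M x : ℕ) : ℕ := if (M + x) % 2 = 0 then M.choose ((M + x)/2) else 0

lemma binN_natAbs (M j : ℕ) : binN M (2 * (j:ℤ) - M).natAbs = M.choose j := by
  unfold binN
  rcases le_or_gt M (2*j) with h | h
  · have : (2 * (j:ℤ) - M).natAbs = 2 * j - M := by omega
    rw [this, if_pos (by omega)]
    congr 1; omega
  · have : (2 * (j:ℤ) - M).natAbs = M - 2 * j := by omega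
    rw [this, if_pos (by omega), ← Nat.choose_symm (by omega)]
    congr 1; omega

lemma U_ballot (h n : ℕ) : ((n:ℤ)+1) * U h n 0 =
    ∑ j ∈ Finset.range (n+2), (2 * (j:ℤ) - (n+1:ℕ)) * (n+1).choose j * eInd h (2 * j - (n+1:ℕ)) := by
  rw [U_eq h n 0 (by simp), wsum_choose]
  unfold rInd
  simp only [mul_sub, Finset.sum_sub_distrib]
  have e1 : ∑ j ∈ Finset.range (n+1), (n.choose j : ℤ) * eInd h (0 + 2 * j - n - 1) =
     ∑ j ∈ Finset.range (n+2), (n.choose j : ℤ) * eInd h (2 * j - (n+1:ℕ)) := by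
    rw [Finset.sum_range_succ _ (n+1), Nat.choose_succ_self]
    simp only [Nat.cast_zero, zero_mul, add_zero]
    apply Finset.sum_congr rfl
    intro j _
    congr 2; push_cast; ring
  rw [e1, Finset.sum_range_succ' _ (n+1), Finset.sum_range_succ' _ (n+1), mul_add, Finset.mul_sum, Finset.mul_sum,
    sub_add_eq_sub_sub, ← Finset.sum_sub_distrib]
  rw [sub_eq_add_neg]
  congr 1
  · apply Finset.sum_congr rfl
    intro j _
    have a1 : ((n:ℤ)+1) * n.choose j = (n+1).choose (j+1) * (j+1) := by
      exact_mod_cast Nat.add_one_mul_choose_eq n j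
    have a2 : ((n+1).choose (j+1) : ℤ) = n.choose j + n.choose (j+1) := by
      exact_mod_cast Nat.choose_succ_succ n j
    have a3 : (0 + 2 * (j:ℤ) - n + 1) = (2 * ((j + 1 : ℕ):ℤ) - ((n + 1 : ℕ):ℤ)) := by push_cast; ring
    rw [a3]
    generalize eInd h _ = E
    push_cast
    rw [a2] at a1 ⊢
    linear_combination (2 * E) * a1
  · simp; ring

lemma V_formula (n h : ℕ) (hn : 1 ≤ n) :
    Summable (fun l : ℕ => (-1:ℝ)^l * (((2*l+1)*(h+1) : ℕ) : ℝ) * binN (n+1) ((2*l+1)*(h+1))) ∧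
    ((n:ℝ)+1) * V n h = 2 * ∑' l : ℕ, (-1:ℝ)^l * (((2*l+1)*(h+1) : ℕ) : ℝ) * binN (n+1) ((2*l+1)*(h+1)) := by
  set M := n+1 with hM
  have binN_big : ∀ x, M < x → binN M x = 0 := by
    intro x hx
    unfold binN
    split_ifs
    · apply Nat.choose_eq_zero_of_lt; omega
    · rfl
  have fin1 : ∀ l : ℕ, l ∉ Finset.range (M+1) → (-1:ℝ)^l * (((2*l+1)*(h+1) : ℕ) : ℝ) * binN M ((2*l+1)*(h+1)) = 0 := by
    intro l hl
    rw [binN_big]; · simp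
    simp at hl
    nlinarith
  have hsum : Summable (fun l : ℕ => (-1:ℝ)^l * (((2*l+1)*(h+1) : ℕ) : ℝ) * binN M ((2*l+1)*(h+1))) :=
    summable_of_ne_finset_zero fin1
  refine ⟨hsum, ?_⟩
  set φ : ℤ → ℝ := fun x => x * binN M x.natAbs * eInd h x with hφ
  have s1 : ((n:ℝ)+1) * V n h = 2 * ∑' x : ℤ, φ x := by
    have := U_ballot h n
    have hv := V_eq_U n h hn
    have hv' : ((n:ℤ)+1) * V n h = 2 * ∑ j ∈ Finset.range (n+2), (2 * (j:ℤ) - (n+1:ℕ)) * (n+1).choose j * eInd h (2 * j - (n+1:ℕ)) := by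
      rw [hv, ← this]; ring
    have hv2 : ((n:ℝ)+1) * V n h = 2 * ∑ j ∈ Finset.range (n+2), (2 * (j:ℝ) - (n+1:ℕ)) * (n+1).choose j * eInd h (2 * j - (n+1:ℕ)) := by
      exact_mod_cast hv'
    rw [hv2]
    congr 1
    have inj : Function.Injective (fun j : ℕ => 2 * (j:ℤ) - (M:ℕ)) := by
      intro a b hab; simp at hab; exact hab
    rw [← inj.tsum_eq]
    · rw [tsum_eq_sum (s := Finset.range (n+2))]
      · apply Finset.sum_congr rfl
        intro j _
        simp only [hφ]
        rw [binN_natAbs, hM]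
        push_cast; ring
      · intro j hj
        simp only [hφ]
        rw [binN_natAbs, Nat.choose_eq_zero_of_lt]; · simp
        simp at hj; omega
    · intro x hx
      simp only [hφ, Function.mem_support, ne_eq, mul_eq_zero, not_or] at hx
      have h2 : x.natAbs ≤ M := by
        by_contra hc
        exact hx.1.2 (by rw [binN_big _ (by omega)]; simp)
      have h3 : (M + x.natAbs) % 2 = 0 := by
        by_contra hc
        exact hx.1.2 (by unfold binN; rw [if_neg hc]; simp)
      refine ⟨((x + M)/2).toNat, ?_⟩
      simp only
      omega
  rw [s1]
  congr 1
  have inj : Function.Injective (fun k : ℤ => (4*k+1)*((h:ℤ)+1)) := by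
    intro a b hab
    simp only at hab
    have := mul_right_cancel₀ (by omega) hab
    omega
  rw [← inj.tsum_eq]
  · have hfs : Summable (fun k : ℤ => φ ((4*k+1)*((h:ℤ)+1))) := by
      apply summable_of_ne_finset_zero (s := Finset.Icc (-(M:ℤ)) M)
      intro k hk
      simp only [hφ]
      rw [binN_big]; · simp
      rw [Int.natAbs_mul]
      have : M < (4*k+1).natAbs := by simp at hk; omega
      have : 1 ≤ ((h:ℤ)+1).natAbs := by omega
      nlinarith
    have e1 : ∀ k : ℕ, φ ((4*(k:ℤ)+1)*((h:ℤ)+1)) = (-1:ℝ)^(2*k) * (((2*(2*k)+1)*(h+1) : ℕ) : ℝ) * binN M ((2*(2*k)+1)*(h+1)) := by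
      intro k
      simp only [hφ]
      have a1 : eInd h ((4*(k:ℤ)+1)*((h:ℤ)+1)) = 1 := by
        unfold eInd; rw [if_pos]; exact ⟨k, by ring⟩
      have a2 : ((4*(k:ℤ)+1)*((h:ℤ)+1)).natAbs = (2*(2*k)+1)*(h+1) := by
        zify; rw [abs_of_nonneg (by positivity)]; ring
      rw [a1, a2, pow_mul]; push_cast; ring
    have e2 : ∀ k : ℕ, φ ((4*(-((k:ℤ)+1))+1)*((h:ℤ)+1)) = (-1:ℝ)^(2*k+1) * (((2*(2*k+1)+1)*(h+1) : ℕ) : ℝ) * binN M ((2*(2*k+1)+1)*(h+1)) := by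
      intro k
      simp only [hφ]
      have a1 : eInd h ((4*(-((k:ℤ)+1))+1)*((h:ℤ)+1)) = 1 := by
        unfold eInd; rw [if_pos]; exact ⟨-((k:ℤ)+1), by ring⟩
      have a2 : ((4*(-((k:ℤ)+1))+1)*((h:ℤ)+1)).natAbs = (2*(2*k+1)+1)*(h+1) := by
        rw [← Int.natAbs_neg]
        zify; rw [abs_of_nonneg (by have : (0:ℤ) ≤ (4*k+3)*(h+1) := by positivity
                                    linarith)]; ring
      rw [a1, a2, pow_succ, pow_mul]; push_cast; ring
    have hs1 : Summable (fun k : ℕ => φ ((4*(k:ℤ)+1)*((h:ℤ)+1))) := hfs.comp_injective Nat.cast_injective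
    have hs2 : Summable (fun k : ℕ => φ ((4*(-((k:ℤ)+1))+1)*((h:ℤ)+1))) :=
      hfs.comp_injective (i := fun k : ℕ => -((k:ℤ)+1)) (by intro a b hab; simp at hab; exact hab)
    have := (HasSum.of_nat_of_neg_add_one (f := fun k : ℤ => φ ((4*k+1)*((h:ℤ)+1))) hs1.hasSum hs2.hasSum).tsum_eq
    rw [this, tsum_congr e1, tsum_congr e2]
    refine tsum_even_add_odd (f := fun l : ℕ => (-1:ℝ)^l * (((2*l+1)*(h+1) : ℕ) : ℝ) * binN M ((2*l+1)*(h+1))) ?_ ?_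
    · exact hs1.congr fun k => (e1 k)
    · exact hs2.congr fun k => (e2 k)
  · intro x hx
    simp only [hφ, Function.mem_support, ne_eq, mul_eq_zero, not_or] at hx
    have h3 : (4 * ((h:ℤ)+1)) ∣ (x - (h+1)) := by
      by_contra hc
      exact hx.2 (by unfold eInd; rw [if_neg hc]; simp)
    obtain ⟨k, hk⟩ := h3
    exact ⟨k, by simp only; linarith⟩
end Part1

section Part2
open Real

/-- Polynomially bounded functions of `s ≥ 0`, `0 ≤ a ≤ 1`. -/
def PB (R : ℝ → ℝ → ℝ) : Prop := ∃ C ≥ (0:ℝ), ∃ K : ℕ, ∀ s a : ℝ, 0 ≤ s → 0 ≤ a → a ≤ 1 → |R s a| ≤ C * (1+s)^K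

lemma PB.const (c : ℝ) : PB (fun _ _ => c) := ⟨|c|, abs_nonneg _, 0, by intros; simp⟩
lemma PB.s : PB (fun s _ => s) := ⟨1, by norm_num, 1, by intro s a hs _ _; rw [abs_of_nonneg hs]; linarith⟩
lemma PB.a : PB (fun _ a => a) := ⟨1, by norm_num, 0, by intro s a hs h h'; rw [abs_of_nonneg h]; linarith⟩
lemma PB.add {R S : ℝ → ℝ → ℝ} (hR : PB R) (hS : PB S) : PB (fun s a => R s a + S s a) := by
  obtain ⟨C, hC, K, h⟩ := hR
  obtain ⟨C', hC', K', h'⟩ := hS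
  refine ⟨C + C', by positivity, K + K', fun s a hs ha ha1 => ?_⟩
  have h1 : (1:ℝ) ≤ (1+s)^K := one_le_pow₀ (by linarith)
  have h2 : (1:ℝ) ≤ (1+s)^K' := one_le_pow₀ (by linarith)
  calc |R s a + S s a| ≤ |R s a| + |S s a| := abs_add_le _ _
    _ ≤ C * (1+s)^K + C' * (1+s)^K' := add_le_add (h s a hs ha ha1) (h' s a hs ha ha1)
    _ ≤ C * ((1+s)^K * (1+s)^K') + C' * ((1+s)^K * (1+s)^K') := by
        gcongr
        · nlinarith
        · nlinarith
    _ = _ := by rw [pow_add]; ring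
lemma PB.mul {R S : ℝ → ℝ → ℝ} (hR : PB R) (hS : PB S) : PB (fun s a => R s a * S s a) := by
  obtain ⟨C, hC, K, h⟩ := hR
  obtain ⟨C', hC', K', h'⟩ := hS
  refine ⟨C * C', by positivity, K + K', fun s a hs ha ha1 => ?_⟩
  rw [abs_mul]
  calc |R s a| * |S s a| ≤ (C * (1+s)^K) * (C' * (1+s)^K') :=
        mul_le_mul (h s a hs ha ha1) (h' s a hs ha ha1) (abs_nonneg _) (by positivity)
    _ = _ := by rw [pow_add]; ring
lemma PB.neg {R : ℝ → ℝ → ℝ} (hR : PB R) : PB (fun s a => - R s a) := by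
  obtain ⟨C, hC, K, h⟩ := hR
  exact ⟨C, hC, K, by simpa using h⟩
lemma PB.sub {R S : ℝ → ℝ → ℝ} (hR : PB R) (hS : PB S) : PB (fun s a => R s a - S s a) := by
  simpa [sub_eq_add_neg] using hR.add hS.neg
lemma PB.pow {R : ℝ → ℝ → ℝ} (hR : PB R) (n : ℕ) : PB (fun s a => R s a ^ n) := by
  induction n with
  | zero => simpa using PB.const 1
  | succ n ih => simpa [pow_succ] using ih.mul hR
lemma PB.div_const {R : ℝ → ℝ → ℝ} (hR : PB R) (c : ℝ) : PB (fun s a => R s a / c) := by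
  simpa [div_eq_mul_inv] using hR.mul (PB.const c⁻¹)

lemma PB.congr {R S : ℝ → ℝ → ℝ} (hR : PB R) (h : ∀ s a, S s a = R s a) : PB S := by
  have : S = R := by ext s a; exact h s a
  rwa [this]

noncomputable def ef1 (s : ℝ) : ℝ := -(s^2)/12
noncomputable def ef2 (s : ℝ) : ℝ := s/6 - s^3/30
noncomputable def ef3 (s : ℝ) : ℝ := s^2/6 - s^4/56
noncomputable def ef4 (s : ℝ) : ℝ := -7*s/30 + s^3/6 - s^5/90
noncomputable def ef5 (s a : ℝ) : ℝ := -7*s^2/12 + s^4/6 + a * (31*s/42 - 49*s^3/45) + a^2*(31*s^2/9) - a^3*(127*s/30)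
noncomputable def eE (s a : ℝ) : ℝ := a * ef1 s + a^2 * ef2 s + a^3 * ef3 s + a^4 * ef4 s + a^5 * ef5 s a

lemma pb_ef1 : PB (fun s _ => ef1 s) := by
  unfold ef1; exact (PB.s.pow 2).neg.div_const 12
lemma pb_ef2 : PB (fun s _ => ef2 s) := by
  unfold ef2; exact (PB.s.div_const 6).sub ((PB.s.pow 3).div_const 30)
lemma pb_ef3 : PB (fun s _ => ef3 s) := by
  unfold ef3; exact ((PB.s.pow 2).div_const 6).sub ((PB.s.pow 4).div_const 56)
lemma pb_ef4 : PB (fun s _ => ef4 s) := by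
  unfold ef4
  exact ((((PB.const (-7)).mul PB.s).div_const 30).add ((PB.s.pow 3).div_const 6)).sub ((PB.s.pow 5).div_const 90)
lemma pb_ef5 : PB (fun s a => ef5 s a) := by
  unfold ef5
  exact (((((((PB.const (-7)).mul (PB.s.pow 2)).div_const 12).add ((PB.s.pow 4).div_const 6)).add
    (PB.a.mul ((((PB.const 31).mul PB.s).div_const 42).sub (((PB.const 49).mul (PB.s.pow 3)).div_const 45)))).add
    ((PB.a.pow 2).mul (((PB.const 31).mul (PB.s.pow 2)).div_const 9)))).sub
    ((PB.a.pow 3).mul (((PB.const 127).mul PB.s).div_const 30))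

/-- Coefficients of the expansion. -/
noncomputable def qc (a : ℝ) : ℕ → ℝ
  | 0 => 1
  | 1 => a^2/6 - 7*a^4/30
  | 2 => -a/12 + a^3/6 + a^4/72
  | 3 => -a^2/30 - a^3/72 + a^4/6
  | 4 => a^2/288 - a^3/56 - 7*a^4/360
  | 5 => a^3/360 - 91*a^4/8640
  | 6 => -a^3/10368 + 103*a^4/50400
  | 7 => -a^4/8640
  | 8 => a^4/497664
  | _ => 0

noncomputable def Qf (s a : ℝ) : ℝ := ∑ k ∈ Finset.range 9, qc a k * s^k

noncomputable def eR2 (f1 f2 f3 t a : ℝ) : ℝ := 2*(f2*f3) + a*f3^2 + 2*((f1 + a*f2 + a^2*f3)*t) + a^3*t^2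
noncomputable def eR3 (f1 f2 t a : ℝ) : ℝ := 3*(f1*f2^2) + a*f2^3 + 3*((f1 + a*f2)^2*t) + 3*(a^2*((f1+a*f2)*t^2)) + a^4*t^3
noncomputable def eR4 (f1 t a : ℝ) : ℝ := 4*(f1^3*t) + 6*(a*(f1^2*t^2)) + 4*(a^2*(f1*t^3)) + a^3*t^4
noncomputable def eR (f1 f2 f3 f4 f5 a : ℝ) : ℝ :=
  f5 + 1/2 * eR2 f1 f2 f3 (f4 + a*f5) a + 1/6 * eR3 f1 f2 (f3 + a*(f4 + a*f5)) a
    + 1/24 * eR4 f1 (f2 + a*(f3 + a*(f4 + a*f5))) a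

lemma taylor_eE (s a : ℝ) : ∑ m ∈ Finset.range 5, eE s a ^ m / (m.factorial : ℝ) =
    Qf s a + a^5 * eR (ef1 s) (ef2 s) (ef3 s) (ef4 s) (ef5 s a) a := by
  have h1 : ∀ f1 f2 f3 f4 f5 : ℝ, ∑ m ∈ Finset.range 5, (a * f1 + a^2 * f2 + a^3 * f3 + a^4 * f4 + a^5 * f5) ^ m / (m.factorial : ℝ)
     = 1 + (f1*a + f2*a^2 + f3*a^3 + f4*a^4 + 1/2*f1^2*a^2 + f1*f2*a^3 + f1*f3*a^4 + 1/2*f2^2*a^4 + 1/6*f1^3*a^3 + 1/2*f1^2*f2*a^4 + 1/24*f1^4*a^4)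
      + a^5 * eR f1 f2 f3 f4 f5 a := by
    intro f1 f2 f3 f4 f5
    simp only [Finset.sum_range_succ, Finset.sum_range_zero, Nat.factorial, eR, eR2, eR3, eR4]
    push_cast
    ring
  unfold eE
  rw [h1]
  congr 1
  simp only [Qf, Finset.sum_range_succ, Finset.sum_range_zero, qc, ef1, ef2, ef3, ef4]
  ring

lemma pb_eR : PB (fun s a => eR (ef1 s) (ef2 s) (ef3 s) (ef4 s) (ef5 s a) a) := by
  unfold eR eR2 eR3 eR4
  repeat' first
    | exact PB.const _
    | exact PB.a
    | exact pb_ef1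
    | exact pb_ef2
    | exact pb_ef3
    | exact pb_ef4
    | exact pb_ef5
    | apply PB.add
    | apply PB.mul
    | apply PB.pow

lemma pb_eE1 : PB (fun s a => ef1 s + a * ef2 s + a^2 * ef3 s + a^3 * ef4 s + a^4 * ef5 s a) :=
  (((pb_ef1.add (PB.a.mul pb_ef2)).add ((PB.a.pow 2).mul pb_ef3)).add ((PB.a.pow 3).mul pb_ef4)).add ((PB.a.pow 4).mul pb_ef5)

lemma pb_Qf : PB Qf := by
  have : PB (fun s a => (1 + (ef1 s*a + ef2 s*a^2 + ef3 s*a^3 + ef4 s*a^4 + 1/2*ef1 s^2*a^2 + ef1 s*ef2 s*a^3 + ef1 s*ef3 s*a^4 + 1/2*ef2 s^2*a^4 + 1/6*ef1 s^3*a^3 + 1/2*ef1 s^2*ef2 s*a^4 + 1/24*ef1 s^4*a^4))) := by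
    repeat' first
      | exact PB.const _
      | exact PB.a
      | exact pb_ef1
      | exact pb_ef2
      | exact pb_ef3
      | exact pb_ef4
      | exact pb_ef5
      | apply PB.add
      | apply PB.mul
      | apply PB.pow
  refine this.congr fun s a => ?_
  simp only [Qf, Finset.sum_range_succ, Finset.sum_range_zero, qc, ef1, ef2, ef3, ef4]
  ring

lemma eE_small (s a : ℝ) (hs : 0 ≤ s) (ha : 0 ≤ a) (ha1 : a ≤ 1/16) (hsa : s^2 * a ≤ 1) : |eE s a| ≤ 1 := by
  have hp : s * a ≤ 1/4 := by
    have : (s*a)^2 ≤ (1/4)^2 := by nlinarith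
    exact le_of_sq_le_sq this (by norm_num)
  have h0 : 0 ≤ s * a := by positivity
  have h0' : 0 ≤ s^2 * a := by positivity
  set p := s * a with hp'
  set q := s^2 * a with hq'
  have e : eE s a = -q/12 + p*a/6 - q*p/30 + q*a^2/6 - 7/30*(p*a^3) - q*p^2/56 + p^3*a/6 - 7/12*(p^2*a^3) + 31/42*(p*a^5)
    - q * p^3/90 + p^4*a/6 - 49/45*(p^3*a^3) + 31/9*(p^2*a^5) - 127/30*(p*a^7) := by
    simp only [eE, ef1, ef2, ef3, ef4, ef5, hp', hq']
    ring
  have b : ∀ i j k : ℕ, 0 ≤ q^i * p^j * a^k ∧ q^i * p^j * a^k ≤ 1 * (1/4)^j * (1/16)^k := by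
    intro i j k
    refine ⟨by positivity, ?_⟩
    gcongr
    exact pow_le_one₀ h0' hsa
  rw [e]
  have b1 := b 1 0 0
  have b2 := b 0 1 1
  have b3 := b 1 1 0
  have b4 := b 1 0 2
  have b5 := b 0 1 3
  have b6 := b 1 2 0
  have b7 := b 0 3 1
  have b8 := b 0 2 3
  have b9 := b 0 1 5
  have b10 := b 1 3 0
  have b11 := b 0 4 1
  have b12 := b 0 3 3
  have b13 := b 0 2 5
  have b14 := b 0 1 7
  norm_num at b1 b2 b3 b4 b5 b6 b7 b8 b9 b10 b11 b12 b13 b14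
  rw [abs_le]
  constructor <;> linarith [b1.1, b1.2, b2.1, b2.2, b3.1, b3.2, b4.1, b4.2, b5.1, b5.2, b6.1, b6.2, b7.1, b7.2, b8.1, b8.2, b9.1, b9.2, b10.1, b10.2, b11.1, b11.2, b12.1, b12.2, b13.1, b13.2, b14.1, b14.2]

lemma exp_expand : ∃ C > (0:ℝ), ∃ K : ℕ, ∀ s a δ : ℝ, 0 ≤ s → 0 ≤ a → a ≤ 1/16 → s^2 * a ≤ 1 → |δ| ≤ 4 * s^6 * a^5 →
    |exp (eE s a + δ) - Qf s a| ≤ C * a^5 * (1+s)^K := by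
  obtain ⟨C1, hC1, K1, h1⟩ := pb_eR
  obtain ⟨C2, hC2, K2, h2⟩ := pb_eE1
  refine ⟨exp 1 * 4 * exp 4 + C2^5 + C1 + 1, by positivity, 6 + 5 * K2 + K1, ?_⟩
  intro s a δ hs ha ha1 hsa hδ
  have hE := eE_small s a hs ha ha1 hsa
  have hδ4 : |δ| ≤ 4 := by
    refine hδ.trans ?_
    have : 4 * s^6 * a^5 = 4 * (s^2*a)^3 * a^2 := by ring
    rw [this]
    have : (s^2*a)^3 ≤ 1 := pow_le_one₀ (by positivity) hsa
    have : a^2 ≤ 1 := pow_le_one₀ ha (by linarith)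
    have : (s^2*a)^3 * a^2 ≤ 1 := mul_le_one₀ ‹_› (by positivity) ‹_›
    linarith
  have t1 : |exp (eE s a + δ) - exp (eE s a)| ≤ exp 1 * (|δ| * exp 4) := by
    rw [exp_add, show exp (eE s a) * exp δ - exp (eE s a) = exp (eE s a) * (exp δ - 1) by ring, abs_mul, abs_of_pos (exp_pos _)]
    apply mul_le_mul
    · exact exp_le_exp.mpr (le_of_abs_le hE)
    · have hb : |exp δ - 1| ≤ |δ| * exp |δ| := by
        rw [abs_le]
        have a1 := add_one_le_exp δ
        have a2 := add_one_le_exp (-δ)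
        have a3 : 1 ≤ exp |δ| := one_le_exp (abs_nonneg _)
        have a4 := neg_abs_le δ
        have a5 := le_abs_self δ
        have a6 := abs_nonneg δ
        constructor
        · nlinarith
        · have : exp δ ≤ exp |δ| := exp_le_exp.mpr a5
          have h7 : exp |δ| * exp (-|δ|) = 1 := by rw [← exp_add]; simp
          have := add_one_le_exp (-|δ|)
          nlinarith [exp_pos |δ|]
      refine hb.trans ?_
      gcongr
    · positivity
    · positivity
  have t2 : |exp (eE s a) - ∑ m ∈ Finset.range 5, eE s a ^ m / (m.factorial : ℝ)| ≤ |eE s a|^5 := by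
    refine (Real.exp_bound hE (n := 5) (by norm_num)).trans ?_
    norm_num [Nat.factorial]
    have : 0 ≤ |eE s a|^5 := by positivity
    linarith
  have t3 : |eE s a| ≤ a * (C2 * (1+s)^K2) := by
    have : eE s a = a * (ef1 s + a * ef2 s + a^2 * ef3 s + a^3 * ef4 s + a^4 * ef5 s a) := by
      unfold eE; ring
    rw [this, abs_mul, abs_of_nonneg ha]
    exact mul_le_mul_of_nonneg_left (h2 s a hs ha (by linarith)) ha
  have t4 : |eE s a|^5 ≤ a^5 * (C2^5 * (1+s)^(5*K2)) := by
    calc |eE s a|^5 ≤ (a * (C2 * (1+s)^K2))^5 := by gcongr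
      _ = _ := by rw [mul_comm 5 K2, pow_mul]; ring
  have t5 := h1 s a hs ha (by linarith)
  rw [taylor_eE] at t2
  set R := eR (ef1 s) (ef2 s) (ef3 s) (ef4 s) (ef5 s a) a
  have hx : (1:ℝ) ≤ 1 + s := by linarith
  have p1 : s^6 ≤ (1+s)^(6 + 5 * K2 + K1) :=
    (pow_le_pow_left₀ hs (by linarith) 6).trans (pow_le_pow_right₀ hx (by omega))
  have p2 : (1+s)^(5*K2) ≤ (1+s)^(6 + 5 * K2 + K1) := pow_le_pow_right₀ hx (by omega)
  have p3 : (1+s)^(K1) ≤ (1+s)^(6 + 5 * K2 + K1) := pow_le_pow_right₀ hx (by omega)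
  set P := (1+s)^(6 + 5 * K2 + K1)
  have hP : 0 ≤ P := by positivity
  have ha5 : 0 ≤ a^5 := by positivity
  calc |exp (eE s a + δ) - Qf s a| = |(exp (eE s a + δ) - exp (eE s a)) + (exp (eE s a) - (Qf s a + a^5 * R)) + a^5 * R| := by
        congr 1; ring
    _ ≤ |exp (eE s a + δ) - exp (eE s a)| + |exp (eE s a) - (Qf s a + a^5 * R)| + |a^5 * R| := abs_add_three _ _ _
    _ ≤ exp 1 * ((4 * P * a^5) * exp 4) + a^5 * (C2^5 * P) + a^5 * (C1 * P) := by
        gcongr ?_ + ?_ + ?_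
        · refine t1.trans ?_
          have : |δ| ≤ 4 * P * a^5 := hδ.trans (by gcongr)
          gcongr
        · refine (t2.trans t4).trans ?_
          gcongr
        · rw [abs_mul, abs_of_nonneg ha5]
          have : |R| ≤ C1 * P := t5.trans (by gcongr)
          gcongr
    _ = (exp 1 * 4 * exp 4 + C2^5 + C1) * a^5 * P := by ring
    _ ≤ _ := mul_le_mul_of_nonneg_right (mul_le_mul_of_nonneg_right (by linarith) ha5) hP
end Part2

section Part3
open Real

lemma binN_step (M x : ℕ) : (binN M (x+2) : ℝ) * ((M:ℝ)+1 + (x+1)) = binN M x * ((M:ℝ)+1 - (x+1)) := by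
  unfold binN
  by_cases h : (M+x)%2 = 0
  · have h2 : (M+(x+2))%2=0 := by omega
    rw [if_pos h, if_pos h2]
    have h3 : (M+(x+2))/2 = (M+x)/2+1 := by omega
    rw [h3]
    set k := (M+x)/2 with hk
    have hk2 : M + x = 2 * k := by omega
    have hkr : (M:ℝ) + x = 2 * k := by exact_mod_cast hk2
    rcases Nat.lt_or_ge M k with hlt | hge
    · rw [Nat.choose_eq_zero_of_lt hlt, Nat.choose_eq_zero_of_lt (by omega)]; simp
    · have := Nat.choose_succ_right_eq M k
      have h4 : (M.choose (k+1) : ℝ) * (k+1) = M.choose k * (M - k) := by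
        rw [← Nat.cast_sub hge]; exact_mod_cast this
      have e1 : (M:ℝ)+1 + (x+1) = 2 * (k+1) := by linarith
      have e2 : (M:ℝ)+1 - (x+1) = 2 * (M - k) := by linarith
      rw [e1, e2]; linarith
  · have h2 : ¬ (M+(x+2))%2=0 := by omega
    rw [if_neg h, if_neg h2]; simp

lemma binN_zero (M x : ℕ) (h : M < x) : binN M x = 0 := by
  unfold binN
  split_ifs
  · exact Nat.choose_eq_zero_of_lt (by omega)
  · rfl

lemma binN_pos (M x : ℕ) (h : x ≤ M) (hp : (M+x)%2=0) : 0 < binN M x := by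
  unfold binN
  rw [if_pos hp]
  exact Nat.choose_pos (by omega)

noncomputable def Tv (v : ℝ) : ℝ := 2*(v+v^3/3+v^5/5+v^7/7+v^9/9)

lemma log_bound (v : ℝ) (h0 : 0 ≤ v) (h1 : v ≤ 1/2) : |log (1-v) - log (1+v) + Tv v| ≤ 4 * v^11 := by
  have a1 := Real.abs_log_sub_add_sum_range_le (x := v) (by rw [abs_of_nonneg h0]; linarith) 10
  have a2 := Real.abs_log_sub_add_sum_range_le (x := -v) (by rw [abs_neg, abs_of_nonneg h0]; linarith) 10
  rw [abs_neg] at a2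
  rw [abs_of_nonneg h0] at a1 a2
  have b : v^(10+1)/(1-v) ≤ 2 * v^11 := by
    rw [div_le_iff₀ (by linarith)]
    have h3 : 0 ≤ v^11 := by positivity
    have h4 := mul_nonneg h3 (sub_nonneg.mpr h1)
    norm_num
    linarith
  have a1' := a1.trans b
  have a2' := a2.trans b
  rw [sub_neg_eq_add] at a2'
  have e : log (1-v) - log (1+v) + Tv v = (∑ i ∈ Finset.range 10, v^(i+1)/((i:ℝ)+1) + log (1-v)) - (∑ i ∈ Finset.range 10, (-v)^(i+1)/((i:ℝ)+1) + log (1+v)) := by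
    simp only [Finset.sum_range_succ, Finset.sum_range_zero, Tv]
    push_cast
    ring
  rw [e]
  refine (abs_sub _ _).trans ?_
  linarith

lemma ratio_le (v : ℝ) (h0 : 0 ≤ v) (h1 : v ≤ 1) : 1 - v ≤ (1+v) * exp (-2*v) := by
  rcases eq_or_lt_of_le h1 with rfl | hlt
  · have := exp_pos (-2*1); linarith
  · have h := Real.hasSum_log_sub_log_of_abs_lt_one (x := v) (by rw [abs_of_nonneg h0]; linarith)
    have := h.summable.le_tsum 0 (fun k _ => by positivity)
    rw [h.tsum_eq] at this
    norm_num at this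
    have h2 : log (1-v) ≤ log (1+v) + (-2*v) := by linarith
    have := exp_le_exp.mpr h2
    rwa [exp_add, exp_log (by linarith), exp_log (by linarith)] at this

noncomputable def Psum (x a : ℝ) : ℝ := x^2/2*a + (x^4/12-x^2/6)*a^3 + (x^6/30-x^4/6+7*x^2/30)*a^5 + (x^8/56-x^6/6+7*x^4/12-31*x^2/42)*a^7
  + (x^10/90-x^8/6+49*x^6/45-31*x^4/9+127*x^2/30)*a^9

lemma Psum_step (x a : ℝ) : Psum (x+2) a = Psum x a + Tv ((x+1)*a) := by
  unfold Psum Tv; ring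

lemma Psum_eq (x a : ℝ) : Psum x a = (x^2*a)/2 - eE (x^2*a) a := by
  unfold Psum eE ef1 ef2 ef3 ef4 ef5; ring

lemma binN_exact (M x0 : ℕ) (hx0 : x0 < 2) (hM : 1 ≤ M) (hp : (M+x0)%2=0) (i : ℕ) (hi : 2*(x0+2*i) ≤ M + 1 ∨ i = 0) :
   ∃ δ : ℝ, |δ| ≤ 4 * ((x0+2*i:ℕ):ℝ)^12 * (1/((M:ℝ)+1))^11 ∧
    (binN M (x0+2*i) : ℝ) = (binN M x0 * exp (Psum x0 (1/((M:ℝ)+1)))) * exp (-Psum ((x0+2*i:ℕ):ℝ) (1/((M:ℝ)+1)) + δ) := by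
  have hA : (0:ℝ) < (M:ℝ)+1 := by positivity
  induction i with
  | zero => refine ⟨0, by rw [abs_zero]; positivity, ?_⟩
            rw [mul_assoc, ← exp_add]; simp
  | succ i ih =>
    have hi' : 2*(x0+2*(i+1)) ≤ M + 1 := by omega
    obtain ⟨δ, hδ, hb⟩ := ih (by omega)
    have st := binN_step M (x0+2*i)
    rw [show x0 + 2*(i+1) = x0+2*i+2 by ring]
    set x := x0+2*i with hx
    set A := (M:ℝ)+1 with hAdef
    set v := ((x:ℝ)+1) * (1/A) with hv
    have hxA : 2*((x:ℝ)+2) ≤ A := by rw [hAdef]; exact_mod_cast (by omega : 2 * (x+2) ≤ M+1)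
    have hxn : (0:ℝ) ≤ x := by positivity
    have hv0 : 0 ≤ v := by positivity
    have hv1 : v ≤ 1/2 := by
      rw [hv, mul_one_div, div_le_iff₀ hA]; linarith
    have hlb := log_bound v hv0 hv1
    set δ' := log (1-v) - log (1+v) + Tv v with hδ'
    refine ⟨δ + δ', ?_, ?_⟩
    · calc |δ + δ'| ≤ |δ| + |δ'| := abs_add_le _ _
        _ ≤ 4 * (x:ℝ)^12 * (1/A)^11 + 4 * v^11 := add_le_add hδ hlb
        _ = 4 * ((x:ℝ)^12 + ((x:ℝ)+1)^11) * (1/A)^11 := by rw [hv]; ring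
        _ ≤ 4 * ((x:ℝ)+2)^12 * (1/A)^11 := by
          gcongr
          have : (x:ℝ)^12 ≤ ((x:ℝ)+1)^11 * x := by
            rw [pow_succ]; gcongr; linarith
          have h2 : ((x:ℝ)+1)^12 ≤ ((x:ℝ)+2)^12 := by gcongr; linarith
          nlinarith
        _ = _ := by push_cast; ring
    · have e : (1 - v) = (1 + v) * exp (-Tv v + δ') := by
        rw [hδ', show -Tv v + (log (1-v) - log (1+v) + Tv v) = log (1-v) - log (1+v) by ring, exp_sub, exp_log (by linarith), exp_log (by linarith)]
        field_simp
      have e1 : A + (x+1) = A * (1+v) := by rw [hv]; field_simp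
      have e2 : A - (x+1) = A * (1-v) := by rw [hv]; field_simp
      rw [e1, e2, e, hb] at st
      have hne : A * (1+v) ≠ 0 := by positivity
      apply mul_right_cancel₀ hne
      rw [st]
      push_cast
      rw [Psum_step, show -(Psum (x:ℝ) (1/A) + Tv (((x:ℝ)+1)*(1/A))) + (δ+δ') = (-Psum (x:ℝ) (1/A) + δ) + (-Tv v + δ') by rw [hv]; ring, exp_add (-Psum (x:ℝ) (1/A) + δ)]
      ring

lemma binN_upper (M x0 : ℕ) (i : ℕ)  :
    (binN M (x0+2*i) : ℝ) ≤ binN M x0 * exp (-(((x0+2*i:ℕ):ℝ)^2 - (x0:ℝ)^2)* (1/((M:ℝ)+1)) / 2) := by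
  have hA : (0:ℝ) < (M:ℝ)+1 := by positivity
  induction i with
  | zero => simp
  | succ i ih =>
    have st := binN_step M (x0+2*i)
    rw [show x0 + 2*(i+1) = x0+2*i+2 by ring]
    set x := x0+2*i with hx
    rcases Nat.lt_or_ge M x with h | h
    · rw [binN_zero M (x+2) (by omega)]
      simp only [Nat.cast_zero]; positivity
    set A := (M:ℝ)+1 with hAdef
    set v := ((x:ℝ)+1) * (1/A) with hv
    have hxA : (x:ℝ)+1 ≤ A := by rw [hAdef]; exact_mod_cast (by omega : x+1 ≤ M+1)
    have hv0 : 0 ≤ v := by positivity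
    have hv1 : v ≤ 1 := by
      rw [hv, mul_one_div, div_le_iff₀ hA]; linarith
    have hr := ratio_le v hv0 hv1
    have e1 : A + (x+1) = A * (1+v) := by rw [hv]; field_simp
    have e2 : A - (x+1) = A * (1-v) := by rw [hv]; field_simp
    rw [e1, e2] at st
    have hpos : 0 < A * (1+v) := by positivity
    refine le_of_mul_le_mul_right ?_ hpos
    rw [st]
    have e3 : exp (-(((x+2:ℕ):ℝ)^2 - (x0:ℝ)^2)* (1/A) / 2) = exp (-((x:ℝ)^2 - (x0:ℝ)^2)* (1/A) / 2) * exp (-2*v) := by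
      rw [← exp_add]; congr 1; rw [hv]; push_cast; ring
    rw [e3]
    calc (binN M x : ℝ) * (A*(1-v)) ≤ (binN M x0 * exp (-((x:ℝ)^2 - (x0:ℝ)^2)* (1/A) / 2)) * (A * ((1+v)*exp (-2*v))) := by
          apply mul_le_mul ih _ _ (by positivity)
          · gcongr
          · have : 0 ≤ 1 - v := by linarith
            positivity
      _ = _ := by ring

lemma binom_approx : ∃ C > (0:ℝ), ∃ K : ℕ, ∀ M : ℕ, 15 ≤ M → ∃ κ > (0:ℝ), ∀ x : ℕ, (M+x)%2 = 0 →
    |(binN M x : ℝ)/κ - exp (-((x:ℝ)^2 * (1/((M:ℝ)+1)))/2) * Qf ((x:ℝ)^2 * (1/((M:ℝ)+1))) (1/((M:ℝ)+1))|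
      ≤ C * (1/((M:ℝ)+1))^5 * (1 + (x:ℝ)^2 * (1/((M:ℝ)+1)))^K * exp (-((x:ℝ)^2 * (1/((M:ℝ)+1)))/2) := by
  obtain ⟨C1, hC1, K1, h1⟩ := exp_expand
  obtain ⟨C2, hC2, K2, h2⟩ := pb_Qf
  refine ⟨C1 + exp 1 + C2, by positivity, K1 + K2 + 10, fun M hM => ?_⟩
  set a : ℝ := 1/((M:ℝ)+1) with ha
  have hA : (0:ℝ) < (M:ℝ)+1 := by positivity
  have ha0 : 0 < a := by positivity
  have ha1 : a ≤ 1/16 := by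
    rw [ha]
    apply one_div_le_one_div_of_le (by norm_num)
    have : (15:ℝ) ≤ M := by exact_mod_cast hM
    linarith
  have hx0 : M % 2 < 2 := Nat.mod_lt _ (by norm_num)
  set x0 := M % 2 with hx0d
  have hb0 : (0:ℝ) < binN M x0 := by exact_mod_cast binN_pos M x0 (by omega) (by omega)
  refine ⟨binN M x0 * exp (Psum x0 a), by positivity, fun x hx => ?_⟩
  obtain ⟨i, rfl⟩ : ∃ i, x = x0 + 2 * i := ⟨(x - x0)/2, by omega⟩
  have up := binN_upper M x0 i
  have ex := binN_exact M x0 hx0 (by omega) (by omega) i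
  rw [← ha] at up ex
  set x := x0 + 2 * i with hxd
  set s : ℝ := (x:ℝ)^2 * a with hs
  have hs0 : 0 ≤ s := by positivity
  have hone : (1:ℝ) ≤ 1 + s := by linarith
  have hpw : ∀ k ≤ K1 + K2 + 10, (1+s)^k ≤ (1+s)^(K1+K2+10) := fun k hk => pow_le_pow_right₀ hone hk
  rcases le_or_gt (s^2*a) 1 with hc | hc
  · have hxa : (x:ℝ) * a ≤ 1/2 := by
      have : ((x:ℝ)*a)^4 ≤ (1/2)^4 := by
        calc ((x:ℝ)*a)^4 = (s^2*a)*a := by rw [hs]; ring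
          _ ≤ 1 * (1/16) := by gcongr
          _ = _ := by norm_num
      exact le_of_pow_le_pow_left₀ (by norm_num) (by norm_num) this
    have hx2 : 2 * x ≤ M + 1 := by
      have : (2:ℝ) * x ≤ M + 1 := by
        rw [ha, mul_one_div, div_le_iff₀ hA] at hxa; linarith
      exact_mod_cast this
    obtain ⟨δ, hδ, hb⟩ := ex (Or.inl hx2)
    have hδ' : |δ| ≤ 4 * s^6 * a^5 := by
      refine hδ.trans (le_of_eq ?_)
      rw [hs]; ring
    have key := h1 s a δ hs0 ha0.le ha1 hc hδ'
    rw [hb, mul_div_assoc, mul_comm, div_mul_cancel₀ _ (by positivity)]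
    rw [Psum_eq, ← hs, show -(s/2 - eE s a) + δ = -s/2 + (eE s a + δ) by ring, exp_add, ← mul_sub, abs_mul, abs_of_pos (exp_pos _)]
    calc exp (-s/2) * |exp (eE s a + δ) - Qf s a| ≤ exp (-s/2) * ((C1 + exp 1 + C2) * a^5 * (1+s)^(K1+K2+10)) := by
          gcongr
          refine key.trans ?_
          have := hpw K1 (by omega)
          have h3 : C1 ≤ C1 + exp 1 + C2 := by have := exp_pos 1; linarith
          gcongr
      _ = _ := by ring
  · have hu : (binN M x:ℝ) / (binN M x0 * exp (Psum x0 a)) ≤ exp 1 * exp (-s/2) := by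
      rw [div_le_iff₀ (by positivity)]
      refine up.trans ?_
      rw [Psum_eq]
      set s0 := (x0:ℝ)^2 * a with hs0d
      have hx01 : (x0:ℝ) ≤ 1 := by exact_mod_cast (by omega : x0 ≤ 1)
      have hx01' : (x0:ℝ)^2 ≤ 1 := pow_le_one₀ (by positivity) hx01
      have hs01 : s0 ≤ 1/16 := by rw [hs0d]; nlinarith
      have hs00 : 0 ≤ s0 := by positivity
      have hE := eE_small s0 a hs00 ha0.le ha1 (by nlinarith)
      have hE' := neg_le_of_abs_le hE
      calc (binN M x0:ℝ) * exp (-((x:ℝ)^2 - (x0:ℝ)^2)*a/2) ≤ binN M x0 * exp (1 + -s/2 + (s0/2 - eE s0 a)) := by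
            gcongr
            have : -((x:ℝ)^2 - (x0:ℝ)^2)*a/2 = -s/2 + s0/2 := by rw [hs, hs0d]; ring
            rw [this]; linarith [le_of_abs_le hE]
        _ = _ := by rw [exp_add, exp_add]; ring
    have hu0 : 0 ≤ (binN M x:ℝ) / (binN M x0 * exp (Psum x0 a)) := by positivity
    have hQ := h2 s a hs0 ha0.le (by linarith)
    have h5 : 1 ≤ a^5 * (1+s)^10 := by
      have : 1 ≤ (s^2*a)^5 := one_le_pow₀ hc.le
      calc 1 ≤ (s^2*a)^5 := this
        _ = a^5 * s^10 := by ring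
        _ ≤ _ := by gcongr; linarith
    have hK2 : (1:ℝ) ≤ (1+s)^(K2) := one_le_pow₀ hone
    have hK1 : (1:ℝ) ≤ (1+s)^(K1) := one_le_pow₀ hone
    have hE := exp_pos (-s/2)
    calc |(binN M x:ℝ) / (binN M x0 * exp (Psum x0 a)) - exp (-s/2) * Qf s a| ≤
        |(binN M x:ℝ) / (binN M x0 * exp (Psum x0 a))| + |exp (-s/2) * Qf s a| := abs_sub _ _
      _ ≤ exp 1 * exp (-s/2) + exp (-s/2) * (C2 * (1+s)^K2) := by
          rw [abs_of_nonneg hu0, abs_mul, abs_of_pos hE]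
          gcongr
      _ ≤ (exp 1 + C2) * (1+s)^K2 * exp (-s/2) := by
          have := exp_pos 1
          have : exp 1 * exp (-s/2) ≤ exp 1 * exp (-s/2) * (1+s)^K2 := le_mul_of_one_le_right (by positivity) hK2
          linarith
      _ ≤ ((C1 + exp 1 + C2) * (1+s)^K2 * exp (-s/2)) * (a^5 * (1+s)^10) * (1+s)^K1 := by
          have hA : (exp 1 + C2) * (1+s)^K2 * exp (-s/2) ≤ (C1 + exp 1 + C2) * (1+s)^K2 * exp (-s/2) := by
            apply mul_le_mul_of_nonneg_right _ hE.le
            apply mul_le_mul_of_nonneg_right _ (by positivity)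
            linarith
          refine hA.trans ?_
          have hp : 0 ≤ (C1 + exp 1 + C2) * (1+s)^K2 * exp (-s/2) := by positivity
          exact (le_mul_of_one_le_right hp h5).trans (le_mul_of_one_le_right (by positivity) hK1)
      _ = _ := by rw [pow_add, pow_add]; ring
end Part3

section Part4
open Real

noncomputable def th (j : ℕ) (t : ℝ) : ℝ := ∑' l : ℕ, (-1:ℝ)^l * (2*(l:ℝ)+1)^(2*j+1) * exp (-(2*(l:ℝ)+1)^2 * t)

lemma summable_od : Summable (fun l : ℕ => 1/(2*(l:ℝ)+1)^2) := by
  have h : Summable (fun n : ℕ => 1/((n:ℝ)+1)^2) := by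
    have := (summable_nat_add_iff 1).mpr (Real.summable_one_div_nat_pow (p := 2) |>.mpr (by norm_num))
    simpa using this
  refine Summable.of_nonneg_of_le (fun l => by positivity) (fun l => ?_) h
  apply one_div_le_one_div_of_le (by positivity)
  have : (0:ℝ) ≤ l := by positivity
  gcongr; linarith

lemma od_ge (l : ℕ) : (1:ℝ) ≤ 2*(l:ℝ)+1 := by
  have : (0:ℝ) ≤ l := by positivity
  linarith

noncomputable def cth (j : ℕ) : ℝ := ((j+2).factorial : ℝ) * 2^(j+2)

lemma cth_pos (j : ℕ) : 0 < cth j := by unfold cth; positivity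

lemma term_bound (j : ℕ) (y t : ℝ) (hy : 1 ≤ y) (ht : 0 < t) :
    y^(2*j+1) * exp (-y^2*t) ≤ cth j * exp (-t/2) / t^(j+2) * (1/y^2) := by
  have hy0 : 0 < y := by linarith
  have h1 := Real.pow_div_factorial_le_exp (y^2*t/2) (by positivity) (j+2)
  rw [div_le_iff₀ (by positivity)] at h1
  have h2 : exp (-y^2*t) = exp (-(y^2*t/2)) * exp (-(y^2*t/2)) := by rw [← exp_add]; congr 1; ring
  have h3 : exp (-(y^2*t/2)) ≤ exp (-t/2) := by
    apply exp_le_exp.mpr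
    have : 1 ≤ y^2 := one_le_pow₀ hy
    nlinarith
  have h4 : exp (-(y^2*t/2)) * (y^2*t/2)^(j+2) ≤ ((j+2).factorial : ℝ) := by
    calc exp (-(y^2*t/2)) * (y^2*t/2)^(j+2) ≤ exp (-(y^2*t/2)) * (exp (y^2*t/2) * ((j+2).factorial : ℝ)) := by gcongr
      _ = _ := by rw [← mul_assoc, ← exp_add]; simp
  have h5 : y^(2*j+1) ≤ y^(2*j+2) := pow_le_pow_right₀ hy (by omega)
  have e : cth j * exp (-t/2) / t^(j+2) * (1/y^2) = (((j+2).factorial : ℝ) * exp (-t/2)) * y^(2*j+2) / (y^2*t/2)^(j+2) := by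
    unfold cth
    rw [div_pow, mul_pow, ← pow_mul]
    field_simp
    ring
  rw [e, le_div_iff₀ (by positivity), h2]
  calc y^(2*j+1) * (exp (-(y^2*t/2)) * exp (-(y^2*t/2))) * (y^2*t/2)^(j+2)
      = y^(2*j+1) * (exp (-(y^2*t/2)) * (exp (-(y^2*t/2)) * (y^2*t/2)^(j+2))) := by ring
    _ ≤ y^(2*j+2) * (exp (-t/2) * ((j+2).factorial : ℝ)) := by gcongr
    _ = _ := by ring

lemma th_term_norm (j l : ℕ) (t : ℝ) (ht : 0 < t) :
    ‖(-1:ℝ)^l * (2*(l:ℝ)+1)^(2*j+1) * exp (-(2*(l:ℝ)+1)^2 * t)‖ ≤ cth j * exp (-t/2) / t^(j+2) * (1/(2*(l:ℝ)+1)^2) := by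
  have h := term_bound j (2*(l:ℝ)+1) t (od_ge l) ht
  rw [mul_assoc, norm_mul, norm_pow, norm_neg, norm_one, one_pow, one_mul, Real.norm_of_nonneg (by positivity)]
  exact h

lemma th_summable (j : ℕ) (t : ℝ) (ht : 0 < t) : Summable (fun l : ℕ => (-1:ℝ)^l * (2*(l:ℝ)+1)^(2*j+1) * exp (-(2*(l:ℝ)+1)^2 * t)) :=
  Summable.of_norm_bounded (summable_od.mul_left _) (fun l => th_term_norm j l t ht)

lemma th_crude (j : ℕ) : ∃ C > (0:ℝ), ∀ t > (0:ℝ), |th j t| ≤ C * exp (-t/2) / t^(j+2) := by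
  refine ⟨cth j * ∑' l : ℕ, 1/(2*(l:ℝ)+1)^2, ?_, fun t ht => ?_⟩
  · have := summable_od.tsum_pos (fun l => by positivity) 0 (by positivity)
    have := cth_pos j
    positivity
  · have := tsum_of_norm_bounded ((summable_od.hasSum).mul_left (cth j * exp (-t/2) / t^(j+2))) (fun l => th_term_norm j l t ht)
    rw [Real.norm_eq_abs] at this
    refine this.trans (le_of_eq ?_)
    ring

lemma th_hasDeriv (j : ℕ) (t : ℝ) (ht : 0 < t) : HasDerivAt (th j) (- th (j+1) t) t := by
  have key := hasDerivAt_tsum_of_isPreconnected (𝕜 := ℝ) (F := ℝ) (t := Set.Ioi (t/2)) (y₀ := t) (y := t)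
    (g := fun (l : ℕ) (s : ℝ) => (-1:ℝ)^l * (2*(l:ℝ)+1)^(2*j+1) * exp (-(2*(l:ℝ)+1)^2 * s))
    (g' := fun (l : ℕ) (s : ℝ) => -((-1:ℝ)^l * (2*(l:ℝ)+1)^(2*(j+1)+1) * exp (-(2*(l:ℝ)+1)^2 * s)))
    (summable_od.mul_left (cth (j+1) * 1 / (t/2)^(j+1+2))) isOpen_Ioi isPreconnected_Ioi ?_ ?_ ?_ (th_summable j t ht) ?_
  · rw [tsum_neg] at key
    exact key
  · intro l s hs
    have h1 : HasDerivAt (fun s : ℝ => -(2*(l:ℝ)+1)^2 * s) (-(2*(l:ℝ)+1)^2 * 1) s := (hasDerivAt_id s).const_mul _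
    have h2 := (h1.exp).const_mul ((-1:ℝ)^l * (2*(l:ℝ)+1)^(2*j+1))
    refine h2.congr_deriv ?_
    ring
  · intro l s hs
    have hs' : t/2 < s := hs
    have hs0 : 0 < s := by linarith
    rw [norm_neg]
    refine (th_term_norm (j+1) l s hs0).trans ?_
    have := cth_pos (j+1)
    gcongr
    exact exp_le_one_iff.mpr (by linarith)
  · simp [ht]
  · simp [ht]

noncomputable def thm (t : ℝ) : ℝ := ∑' l : ℕ, (-1:ℝ)^l / (2*(l:ℝ)+1) * exp (-(2*(l:ℝ)+1)^2 * t)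

lemma thm_term_norm (l : ℕ) (t : ℝ) (ht : 0 < t) :
    ‖(-1:ℝ)^l / (2*(l:ℝ)+1) * exp (-(2*(l:ℝ)+1)^2 * t)‖ ≤ cth 0 * exp (-t/2) / t^2 * (1/(2*(l:ℝ)+1)^2) := by
  have h := term_bound 0 (2*(l:ℝ)+1) t (od_ge l) ht
  have ho := od_ge l
  rw [div_mul_eq_mul_div, norm_div, norm_mul, norm_pow, norm_neg, norm_one, one_pow, one_mul, Real.norm_of_nonneg (by positivity), Real.norm_of_nonneg (by positivity)]
  refine le_trans ?_ h
  rw [div_le_iff₀ (by positivity)]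
  have : 1 ≤ (2*(l:ℝ)+1)^(2*0+1) * (2*(l:ℝ)+1) := by
    simp only [mul_zero, zero_add, pow_one]; nlinarith
  have he := exp_pos (-(2*(l:ℝ)+1)^2 * t)
  nlinarith

lemma thm_summable (t : ℝ) (ht : 0 < t) : Summable (fun l : ℕ => (-1:ℝ)^l / (2*(l:ℝ)+1) * exp (-(2*(l:ℝ)+1)^2 * t)) :=
  Summable.of_norm_bounded (summable_od.mul_left _) (fun l => thm_term_norm l t ht)

lemma thm_crude : ∃ C > (0:ℝ), ∀ t > (0:ℝ), |thm t| ≤ C * exp (-t/2) / t^2 := by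
  refine ⟨cth 0 * ∑' l : ℕ, 1/(2*(l:ℝ)+1)^2, ?_, fun t ht => ?_⟩
  · have := summable_od.tsum_pos (fun l => by positivity) 0 (by positivity)
    have := cth_pos 0
    positivity
  · have := tsum_of_norm_bounded ((summable_od.hasSum).mul_left (cth 0 * exp (-t/2) / t^2)) (fun l => thm_term_norm l t ht)
    rw [Real.norm_eq_abs] at this
    refine this.trans (le_of_eq ?_)
    ring

lemma thm_hasDeriv (t : ℝ) (ht : 0 < t) : HasDerivAt thm (- th 0 t) t := by
  have key := hasDerivAt_tsum_of_isPreconnected (𝕜 := ℝ) (F := ℝ) (t := Set.Ioi (t/2)) (y₀ := t) (y := t)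
    (g := fun (l : ℕ) (s : ℝ) => (-1:ℝ)^l / (2*(l:ℝ)+1) * exp (-(2*(l:ℝ)+1)^2 * s))
    (g' := fun (l : ℕ) (s : ℝ) => -((-1:ℝ)^l * (2*(l:ℝ)+1)^(2*0+1) * exp (-(2*(l:ℝ)+1)^2 * s)))
    (summable_od.mul_left (cth 0 * 1 / (t/2)^(0+2))) isOpen_Ioi isPreconnected_Ioi ?_ ?_ ?_ (thm_summable t ht) ?_
  · rw [tsum_neg] at key
    exact key
  · intro l s hs
    have h1 : HasDerivAt (fun s : ℝ => -(2*(l:ℝ)+1)^2 * s) (-(2*(l:ℝ)+1)^2 * 1) s := (hasDerivAt_id s).const_mul _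
    have h2 := (h1.exp).const_mul ((-1:ℝ)^l / (2*(l:ℝ)+1))
    refine h2.congr_deriv ?_
    have := od_ge l
    field_simp
    ring
  · intro l s hs
    have hs' : t/2 < s := hs
    have hs0 : 0 < s := by linarith
    rw [norm_neg]
    refine (th_term_norm 0 l s hs0).trans ?_
    have := cth_pos 0
    gcongr
    exact exp_le_one_iff.mpr (by linarith)
  · simp [ht]
  · simp [ht]

lemma th0_sinKernel (t : ℝ) (ht : 0 < t) : HurwitzZeta.sinKernel ((1/4 : ℝ) : UnitAddCircle) (t/π) = 2 * th 0 t := by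
  have h := HurwitzZeta.hasSum_nat_sinKernel (1/4) (t := t/π) (by positivity)
  have inj : Function.Injective (fun l : ℕ => 2*l+1) := fun a b h => by simpa using h
  rw [← inj.hasSum_iff] at h
  · rw [← h.tsum_eq, th, ← tsum_mul_left]
    congr 1; ext l
    have e1 : sin (2*π*(1/4)*((2*l+1:ℕ):ℝ)) = (-1)^l := by
      rw [show 2*π*(1/4)*((2*l+1:ℕ):ℝ) = l * π + π/2 by push_cast; ring, Real.sin_add_pi_div_two, Real.cos_nat_mul_pi]
    have e2 : -π * ((2*l+1:ℕ):ℝ)^2 * (t/π) = -(2*(l:ℝ)+1)^2 * t := by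
      have := pi_pos
      push_cast; field_simp
    simp only [Function.comp]
    rw [e1, e2]; push_cast; ring
  · intro x hx
    have : ∃ k, x = 2*k := by
      rcases Nat.even_or_odd' x with ⟨k, rfl | rfl⟩
      · exact ⟨k, rfl⟩
      · exact absurd ⟨k, rfl⟩ hx
    obtain ⟨k, rfl⟩ := this
    rw [show 2*π*(1/4)*((2*k:ℕ):ℝ) = k * π by push_cast; ring, Real.sin_nat_mul_pi]; simp

lemma th_bdd_of (j L : ℕ) (t0 : ℝ) (ht0 : 0 < t0) (C : ℝ) (h : ∀ t, 0 < t → t ≤ t0 → |th j t| ≤ C * t^L) :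
    ∃ C' > (0:ℝ), ∀ t > 0, |th j t| ≤ C' * t^L := by
  obtain ⟨C1, hC1, h1⟩ := th_crude j
  refine ⟨max C 0 + C1 / t0^(j+2) / t0^L, by positivity, fun t ht => ?_⟩
  rcases le_or_gt t t0 with h2 | h2
  · refine (h t ht h2).trans ?_
    gcongr
    have : 0 < C1 / t0^(j+2) / t0^L := by positivity
    linarith [le_max_left C 0]
  · refine (h1 t ht).trans ?_
    calc C1 * exp (-t/2) / t^(j+2) ≤ C1 * 1 / t0^(j+2) := by
          gcongr
          exact exp_le_one_iff.mpr (by linarith)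
      _ = C1 / t0^(j+2) / t0^L * t0^L := by field_simp
      _ ≤ C1 / t0^(j+2) / t0^L * t^L := by gcongr
      _ ≤ _ := by
        gcongr
        linarith [le_max_right C 0]

lemma th0_flat (L : ℕ) : ∃ C > (0:ℝ), ∀ t > 0, |th 0 t| ≤ C * t^L := by
  obtain ⟨p, hp, hO⟩ := HurwitzZeta.isBigO_atTop_oddKernel ((1/4 : ℝ) : UnitAddCircle)
  obtain ⟨c, hc0, hc⟩ := hO.exists_pos
  rw [Asymptotics.isBigOWith_iff, Filter.eventually_atTop] at hc
  obtain ⟨x0, hx0⟩ := hc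
  set x1 := max x0 1 with hx1
  have hx1pos : 1 ≤ x1 := le_max_right _ _
  set D : ℝ := ((L+2).factorial : ℝ) / p^(L+2) with hD
  refine th_bdd_of 0 L (π/x1) (by positivity) (c * D / 2 / π^L) ?_
  intro t ht htx
  set x := π / t with hx
  have hpi := pi_pos
  have hxx : x1 ≤ x := by
    rw [hx, le_div_iff₀ ht]
    rw [le_div_iff₀ (by positivity)] at htx
    linarith
  have hxpos : 1 ≤ x := by linarith
  have fe := HurwitzZeta.oddKernel_functional_equation ((1/4 : ℝ) : UnitAddCircle) x
  have e1 : 1/x = t/π := by rw [hx]; field_simp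
  rw [e1, th0_sinKernel t ht] at fe
  have hb := hx0 x ((le_max_left _ _).trans hxx)
  rw [fe, Real.norm_eq_abs, Real.norm_eq_abs, abs_of_pos (exp_pos _), abs_mul, abs_mul, abs_of_pos (by positivity : (0:ℝ) < 1/x^(3/2:ℝ))] at hb
  norm_num at hb
  have hxr : 0 < x^(3/2:ℝ) := by positivity
  rw [inv_mul_le_iff₀ hxr] at hb
  have hx2 : x^(3/2:ℝ) ≤ x^2 := by
    rw [← Real.rpow_natCast]
    exact Real.rpow_le_rpow_of_exponent_le hxpos (by norm_num)
  have hex := Real.pow_div_factorial_le_exp (p*x) (by positivity) (L+2)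
  rw [div_le_iff₀ (by positivity)] at hex
  have h6 : exp (-(p*x)) * x^(L+2) ≤ D := by
    rw [hD, le_div_iff₀ (by positivity)]
    calc exp (-(p*x)) * x^(L+2) * p^(L+2) = exp (-(p*x)) * (p*x)^(L+2) := by rw [mul_pow]; ring
      _ ≤ exp (-(p*x)) * (exp (p*x) * ((L+2).factorial : ℝ)) := by gcongr
      _ = _ := by rw [← mul_assoc, ← exp_add]; simp
  have e2 : t^L = π^L / x^L := by rw [hx, div_pow]; field_simp
  rw [e2, show c * D / 2 / π^L * (π^L / x^L) = c * D / 2 / x^L by field_simp, le_div_iff₀ (by positivity)]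
  have h7 : 2 * |th 0 t| ≤ x^2 * (c * exp (-(p*x))) := hb.trans (by gcongr)
  calc |th 0 t| * x^L = (2 * |th 0 t|) * x^L / 2 := by ring
    _ ≤ (x^2 * (c * exp (-(p*x)))) * x^L / 2 := by gcongr
    _ = c * (exp (-(p*x)) * x^(L+2)) / 2 := by rw [pow_add]; ring
    _ ≤ c * D / 2 := by gcongr

lemma th_flat (j : ℕ) : ∀ L : ℕ, ∃ C > (0:ℝ), ∀ t > 0, |th j t| ≤ C * t^L := by
  induction j with
  | zero => exact th0_flat
  | succ j ih =>
    intro L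
    obtain ⟨C1, hC1, h1⟩ := ih (2*L+j+4)
    obtain ⟨C2, hC2, h2⟩ := th_crude (j+2)
    refine th_bdd_of (j+1) L 1 one_pos (C1 * 2^(2*L+j+4) + C1 + C2) ?_
    intro t ht ht1
    set η := t^(L+j+4) with hη
    have hη0 : 0 < η := by positivity
    have hηt : η ≤ t := by
      calc t^(L+j+4) ≤ t^1 := pow_le_pow_of_le_one ht.le ht1 (by omega)
        _ = t := pow_one t
    have pos : ∀ s ∈ Set.Icc t (t+η), 0 < s := fun s hs => lt_of_lt_of_le ht hs.1
    obtain ⟨ξ, hξ, e1⟩ := exists_hasDerivAt_eq_slope (th j) (fun s => - th (j+1) s) (a := t) (b := t+η) (by linarith)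
      (fun s hs => (th_hasDeriv j s (pos s hs)).continuousAt.continuousWithinAt)
      (fun s hs => th_hasDeriv j s (pos s ⟨hs.1.le, hs.2.le⟩))
    obtain ⟨ζ, hζ, e2⟩ := exists_hasDerivAt_eq_slope (th (j+1)) (fun s => - th (j+2) s) (a := t) (b := ξ) hξ.1
      (fun s hs => (th_hasDeriv (j+1) s (pos s ⟨hs.1, hs.2.trans hξ.2.le⟩)).continuousAt.continuousWithinAt)
      (fun s hs => th_hasDeriv (j+1) s (pos s ⟨hs.1.le, (hs.2.trans hξ.2).le⟩))
    have hζ0 : 0 < ζ := ht.trans hζ.1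
    have b2 : |th (j+2) ζ| ≤ C2 / t^(j+4) := by
      refine (h2 ζ hζ0).trans ?_
      calc C2 * exp (-ζ/2) / ζ^(j+2+2) ≤ C2 * 1 / t^(j+2+2) := by
            gcongr
            · exact exp_le_one_iff.mpr (by linarith)
            · exact hζ.1.le
        _ = _ := by rw [mul_one]
    rw [eq_div_iff (by linarith [hξ.1])] at e2
    rw [eq_div_iff (by linarith)] at e1
    simp only [add_sub_cancel_left] at e1
    have a1 : |th (j+1) ξ| * η ≤ (C1 * 2^(2*L+j+4) + C1) * t^(2*L+j+4) := by
      have : |th (j+1) ξ| * η = |th j (t+η) - th j t| := by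
        rw [← e1, abs_mul, abs_neg, abs_of_pos hη0]
      rw [this]
      refine (abs_sub _ _).trans ?_
      have i1 := h1 t ht
      have i2 := h1 (t+η) (by positivity)
      have i3 : (t+η)^(2*L+j+4) ≤ (2*t)^(2*L+j+4) := by gcongr; linarith
      rw [mul_pow] at i3
      have := mul_le_mul_of_nonneg_left i3 hC1.le
      linarith
    have e5 : t^(2*L+j+4) = t^L * η := by rw [hη, ← pow_add]; congr 1; ring
    have a2 : |th (j+1) ξ| ≤ (C1 * 2^(2*L+j+4) + C1) * t^L := by
      rw [e5, ← mul_assoc] at a1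
      exact le_of_mul_le_mul_right a1 hη0
    have a3 : |th (j+1) ξ - th (j+1) t| ≤ C2 * t^L := by
      rw [← e2, abs_mul, abs_neg, abs_of_pos (by linarith [hξ.1] : 0 < ξ - t)]
      calc |th (j+2) ζ| * (ξ - t) ≤ C2 / t^(j+4) * η := by
            apply mul_le_mul b2 (by linarith [hξ.2]) (by linarith [hξ.1]) (by positivity)
        _ = C2 * t^L := by rw [hη, show L+j+4 = L+(j+4) by ring, pow_add]; field_simp; ring
    have : th (j+1) t = th (j+1) ξ - (th (j+1) ξ - th (j+1) t) := by ring
    rw [this]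
    refine (abs_sub _ _).trans ?_
    linarith

/-- decay at infinity, all powers -/
lemma th_decay (j m : ℕ) : ∃ C > (0:ℝ), ∀ t > 0, |th j t| * t^m ≤ C := by
  obtain ⟨C0, hC0, h0⟩ := th_flat j 0
  obtain ⟨C1, hC1, h1⟩ := th_crude j
  refine ⟨C0 + C1 * ((m.factorial:ℝ) * 2^m), by positivity, fun t ht => ?_⟩
  have hp : 0 < C1 * ((m.factorial:ℝ) * 2^m) := by positivity
  rcases le_or_gt t 1 with h | h
  · have a1 := h0 t ht
    have a2 : t^m ≤ 1 := pow_le_one₀ ht.le h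
    rw [pow_zero, mul_one] at a1
    have := mul_le_mul a1 a2 (by positivity) hC0.le
    linarith
  · have a1 := h1 t ht
    have a3 := Real.pow_div_factorial_le_exp (t/2) (by positivity) m
    rw [div_le_iff₀ (by positivity)] at a3
    have a4 : exp (-t/2) * t^m ≤ (m.factorial:ℝ) * 2^m := by
      calc exp (-t/2) * t^m = exp (-t/2) * (t/2)^m * 2^m := by rw [div_pow]; field_simp
        _ ≤ exp (-t/2) * (exp (t/2) * (m.factorial:ℝ)) * 2^m := by gcongr
        _ = _ := by rw [← mul_assoc (exp _), ← exp_add]; ring_nf; simp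
    have a5 : C1 * exp (-t/2) / t^(j+2) ≤ C1 * exp (-t/2) := div_le_self (by positivity) (one_le_pow₀ h.le)
    calc |th j t| * t^m ≤ (C1 * exp (-t/2)) * t^m := by gcongr; exact a1.trans a5
      _ = C1 * (exp (-t/2) * t^m) := by ring
      _ ≤ C1 * ((m.factorial:ℝ) * 2^m) := by gcongr
      _ ≤ _ := by linarith
end Part4

section Part5
open Real MeasureTheory

noncomputable def Gf (b j : ℕ) (y : ℝ) : ℝ := if 0 < y then y^b * th j (y^2/2) else 0

lemma Gf_pos (b j : ℕ) (y : ℝ) (hy : 0 < y) : Gf b j y = y^b * th j (y^2/2) := if_pos hy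
lemma Gf_nonpos (b j : ℕ) (y : ℝ) (hy : y ≤ 0) : Gf b j y = 0 := if_neg (not_lt.mpr hy)

lemma Gf_bound (b j : ℕ) : ∃ C > (0:ℝ), ∀ y, |Gf b j y| ≤ C * y^2 ∧ |Gf b j y| ≤ C * (1+y^2)⁻¹ := by
  obtain ⟨C1, hC1, h1⟩ := th_flat j 1
  obtain ⟨C2, hC2, h2⟩ := th_decay j (b+1)
  set D := 2^(b+1) * C2 with hD
  have hD0 : 0 < D := by positivity
  refine ⟨2 * (C1 + D), by positivity, fun y => ?_⟩
  rcases le_or_gt y 0 with hy | hy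
  · rw [Gf_nonpos b j y hy, abs_zero]
    constructor <;> positivity
  rw [Gf_pos b j y hy, abs_mul, abs_of_pos (by positivity : 0 < y^b)]
  have t0 : 0 < y^2/2 := by positivity
  have a1 := h1 _ t0
  have a2 := h2 _ t0
  rw [pow_one] at a1
  have hy2 : 0 < y^2 := by positivity
  rcases le_or_gt y 1 with h | h
  · have hb : y^b ≤ 1 := pow_le_one₀ hy.le h
    have hy21 : y^2 ≤ 1 := pow_le_one₀ hy.le h
    have k : y^b * |th j (y^2/2)| ≤ 1 * (C1 * (y^2/2)) := mul_le_mul hb a1 (abs_nonneg _) (by norm_num)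
    constructor
    · nlinarith
    · refine k.trans ?_
      rw [le_mul_inv_iff₀ (by positivity)]
      have q : C1 * (y^2/2) ≤ C1 * (1/2) := by gcongr
      have q2 : 1 * (C1 * (y^2/2)) * (1+y^2) ≤ (C1 * (1/2)) * 2 := by
        rw [one_mul]
        exact mul_le_mul q (by linarith) (by positivity) (by positivity)
      linarith
  · have hy21 : 1 ≤ y^2 := one_le_pow₀ h.le
    have hb : y^b ≤ (y^2)^b := by
      gcongr
      nlinarith
    have k : y^b * |th j (y^2/2)| * y^2 ≤ D := by
      calc y^b * |th j (y^2/2)| * y^2 ≤ (y^2)^b * |th j (y^2/2)| * y^2 := by gcongr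
        _ = 2^(b+1) * (|th j (y^2/2)| * (y^2/2)^(b+1)) := by rw [div_pow]; field_simp; ring
        _ ≤ D := by rw [hD]; gcongr
    have k1 : y^b * |th j (y^2/2)| ≤ D := by
      refine le_trans ?_ k
      exact le_mul_of_one_le_right (by positivity) hy21
    constructor
    · nlinarith
    · rw [le_mul_inv_iff₀ (by positivity)]
      nlinarith

lemma Gf_hasDeriv (b j : ℕ) (y : ℝ) : HasDerivAt (Gf b j) (b * Gf (b-1) j y - Gf (b+1) (j+1) y) y := by
  rcases lt_trichotomy y 0 with hy | rfl | hy
  · rw [Gf_nonpos _ _ y hy.le, Gf_nonpos _ _ y hy.le, mul_zero, sub_zero]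
    refine (hasDerivAt_const y (0:ℝ)).congr_of_eventuallyEq ?_
    filter_upwards [gt_mem_nhds hy] with z hz
    exact Gf_nonpos _ _ z (le_of_lt hz)
  · rw [Gf_nonpos _ _ 0 le_rfl, Gf_nonpos _ _ 0 le_rfl, mul_zero, sub_zero]
    obtain ⟨C, hC, h⟩ := Gf_bound b j
    rw [hasDerivAt_iff_isLittleO]
    simp only [sub_zero, smul_zero, Gf_nonpos b j 0 le_rfl]
    have h1 : (fun x' => Gf b j x') =O[nhds 0] (fun x' : ℝ => x'^2) := by
      refine Asymptotics.IsBigO.of_bound C (Filter.Eventually.of_forall fun x => ?_)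
      rw [Real.norm_eq_abs, Real.norm_of_nonneg (by positivity)]
      exact (h x).1
    exact h1.trans_isLittleO (Asymptotics.isLittleO_pow_id (by norm_num))
  · rw [Gf_pos _ _ y hy, Gf_pos _ _ y hy]
    have h1 : HasDerivAt (fun z : ℝ => z^2/2) y y := by
      have := ((hasDerivAt_pow 2 y).div_const 2)
      refine this.congr_deriv ?_
      norm_num
    have h2 := (th_hasDeriv j (y^2/2) (by positivity)).comp y h1
    have h3 := (hasDerivAt_pow b y).mul h2
    refine (h3.congr_of_eventuallyEq ?_).congr_deriv ?_
    · filter_upwards [lt_mem_nhds hy] with z hz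
      rw [Gf_pos _ _ z hz]; rfl
    · simp only [Function.comp]; ring

lemma Gf_cont (b j : ℕ) : Continuous (Gf b j) :=
  continuous_iff_continuousAt.mpr fun y => (Gf_hasDeriv b j y).continuousAt

lemma Gf_integrable (b j : ℕ) : Integrable (Gf b j) := by
  obtain ⟨C, hC, h⟩ := Gf_bound b j
  refine (integrable_inv_one_add_sq.const_mul C).mono' (Gf_cont b j).aestronglyMeasurable ?_
  exact Filter.Eventually.of_forall fun y => (h y).2

lemma Gf_moment (b j : ℕ) : ∫ y, Gf (b+1) (j+1) y = b * ∫ y, Gf (b-1) j y := by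
  have h := integral_eq_zero_of_hasDerivAt_of_integrable (Gf_hasDeriv b j)
    (((Gf_integrable (b-1) j).const_mul _).sub (Gf_integrable (b+1) (j+1))) (Gf_integrable b j)
  rw [integral_sub ((Gf_integrable (b-1) j).const_mul _) (Gf_integrable (b+1) (j+1)), integral_const_mul] at h
  linarith

noncomputable def GC (b j : ℕ) (y : ℝ) : ℂ := (Gf b j y : ℂ)

lemma GC_hasDeriv (b j : ℕ) (y : ℝ) : HasDerivAt (GC b j) (b * GC (b-1) j y - GC (b+1) (j+1) y) y := by
  have := (Gf_hasDeriv b j y).ofReal_comp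
  refine this.congr_deriv ?_
  unfold GC; push_cast; rfl

lemma GC_integrable (b j : ℕ) : Integrable (GC b j) := (Gf_integrable b j).ofReal

open FourierTransform in
lemma GC_fourier_decay (K : ℕ) : ∀ b j : ℕ, ∃ C > (0:ℝ), ∀ ξ : ℝ, |ξ|^K * ‖𝓕 (GC b j) ξ‖ ≤ C := by
  induction K with
  | zero =>
    intro b j
    refine ⟨(∫ y, ‖GC b j y‖) + 1, ?_, fun ξ => ?_⟩
    · have : 0 ≤ ∫ y, ‖GC b j y‖ := integral_nonneg fun _ => norm_nonneg _
      linarith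
    · rw [pow_zero, one_mul]
      have : ‖𝓕 (GC b j) ξ‖ ≤ ∫ y, ‖GC b j y‖ := VectorFourier.norm_fourierIntegral_le_integral_norm ..
      linarith
  | succ K ih =>
    intro b j
    obtain ⟨C1, hC1, h1⟩ := ih (b-1) j
    obtain ⟨C2, hC2, h2⟩ := ih (b+1) (j+1)
    refine ⟨b * C1 + C2, by positivity, fun ξ => ?_⟩
    have hd : deriv (GC b j) = fun y => (b:ℂ) * GC (b-1) j y - GC (b+1) (j+1) y := funext fun y => (GC_hasDeriv b j y).deriv
    have hIntegr : Integrable (fun y => (b:ℂ) * GC (b-1) j y - GC (b+1) (j+1) y) := ((GC_integrable _ _).const_mul _).sub (GC_integrable _ _)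
    have hf := Real.fourier_deriv (GC_integrable b j) (fun y => (GC_hasDeriv b j y).differentiableAt) (by rw [hd]; exact hIntegr)
    have hf' := congrFun hf ξ
    have e : 𝓕 (deriv (GC b j)) ξ = b * 𝓕 (GC (b-1) j) ξ - 𝓕 (GC (b+1) (j+1)) ξ := by
      rw [hd]
      simp only [Real.fourier_eq]
      rw [← integral_const_mul, ← integral_sub]
      · congr 1; ext y; simp only [Circle.smul_def, smul_eq_mul]; ring
      · exact ((Real.fourierIntegral_convergent_iff ξ).mpr (GC_integrable _ _)).const_mul _
      · exact ((Real.fourierIntegral_convergent_iff ξ).mpr (GC_integrable _ _))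
    rw [e] at hf'
    have hn := congrArg norm hf'
    rw [norm_smul] at hn
    have e3 : ‖(2 * (π:ℂ) * Complex.I * (ξ:ℂ))‖ = 2 * π * |ξ| := by
      simp [abs_of_pos pi_pos]
    rw [e3] at hn
    have hle : |ξ| * ‖𝓕 (GC b j) ξ‖ ≤ b * ‖𝓕 (GC (b-1) j) ξ‖ + ‖𝓕 (GC (b+1) (j+1)) ξ‖ := by
      calc |ξ| * ‖𝓕 (GC b j) ξ‖ ≤ 2 * π * |ξ| * ‖𝓕 (GC b j) ξ‖ := by
            have : 1 ≤ 2 * π := by linarith [Real.pi_gt_three]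
            have h0 : 0 ≤ |ξ| * ‖𝓕 (GC b j) ξ‖ := by positivity
            nlinarith
        _ = ‖(b:ℂ) * 𝓕 (GC (b-1) j) ξ - 𝓕 (GC (b+1) (j+1)) ξ‖ := hn.symm
        _ ≤ ‖(b:ℂ) * 𝓕 (GC (b-1) j) ξ‖ + ‖𝓕 (GC (b+1) (j+1)) ξ‖ := norm_sub_le _ _
        _ = _ := by rw [norm_mul]; simp
    calc |ξ|^(K+1) * ‖𝓕 (GC b j) ξ‖ = |ξ|^K * (|ξ| * ‖𝓕 (GC b j) ξ‖) := by ring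
      _ ≤ |ξ|^K * (b * ‖𝓕 (GC (b-1) j) ξ‖ + ‖𝓕 (GC (b+1) (j+1)) ξ‖) := by gcongr
      _ = b * (|ξ|^K * ‖𝓕 (GC (b-1) j) ξ‖) + |ξ|^K * ‖𝓕 (GC (b+1) (j+1)) ξ‖ := by ring
      _ ≤ _ := by
        have := h1 ξ
        have := h2 ξ
        gcongr
end Part5

section Part6
open Real MeasureTheory FourierTransform

lemma fourier_scale (g : ℝ → ℂ) (c : ℝ) (hc : 0 < c) (ξ : ℝ) : 𝓕 (fun x => g (c*x)) ξ = (c⁻¹ : ℝ) • 𝓕 g (ξ/c) := by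
  rw [Real.fourier_real_eq, Real.fourier_real_eq]
  have h := Measure.integral_comp_mul_left (fun w : ℝ => (𝐞 (-(w * (ξ/c))) : Circle) • g w) c
  rw [abs_of_pos (inv_pos.mpr hc)] at h
  rw [← h]
  congr 1; ext v
  congr 3
  field_simp

lemma poisson_G (b j K : ℕ) : ∃ C > (0:ℝ), ∀ ε : ℝ, 0 < ε → ε ≤ 1 → ∀ p : ℕ, p = 1 ∨ p = 2 →
    |∑' i : ℕ, Gf b j (ε * ((2*i+p : ℕ):ℝ)) - 1/(2*ε) * ∫ y, Gf b j y| ≤ C * ε^K := by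
  obtain ⟨C, hC, hdec⟩ := GC_fourier_decay (K+2) b j
  obtain ⟨B, hB, hbd⟩ := Gf_bound b j
  have hs2 : Summable (fun n : ℤ => 1/(n:ℝ)^2) := Real.summable_one_div_int_pow.mpr (by norm_num)
  have hS0 : 0 ≤ ∑' n : ℤ, 1/(n:ℝ)^2 := tsum_nonneg fun n => by positivity
  refine ⟨C * 2^(K+1) * (∑' n : ℤ, 1/(n:ℝ)^2) + 1, by positivity, fun ε hε hε1 p hp => ?_⟩
  have hc : 0 < 2*ε := by positivity
  set f : ℝ → ℂ := fun x => GC b j (2*ε*x) with hf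
  have hcont : Continuous f := by
    have : Continuous (GC b j) := Complex.continuous_ofReal.comp (Gf_cont b j)
    exact this.comp (by fun_prop)
  have hfO : f =O[Filter.cocompact ℝ] (fun x => |x|^(-(2:ℝ))) := by
    refine Asymptotics.IsBigO.of_bound (B / (2*ε)^2) ?_
    filter_upwards [(isCompact_singleton (x := (0:ℝ))).compl_mem_cocompact] with x hx
    have hx0 : x ≠ 0 := hx
    rw [Real.rpow_neg (abs_nonneg x), Real.rpow_two, sq_abs, norm_inv, Real.norm_of_nonneg (by positivity)]
    have h1 := (hbd (2*ε*x)).2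
    have h2 : ‖f x‖ = |Gf b j (2*ε*x)| := by rw [hf]; simp [GC]
    rw [h2]
    refine h1.trans ?_
    have hx2 : 0 < x^2 := by positivity
    rw [div_mul_eq_mul_div, ← mul_div, ]
    gcongr
    rw [inv_eq_one_div, inv_eq_one_div, div_div]
    apply one_div_le_one_div_of_le (by positivity)
    nlinarith
  have hF : ∀ ξ, 𝓕 f ξ = ((2*ε)⁻¹ : ℝ) • 𝓕 (GC b j) (ξ/(2*ε)) := fun ξ => fourier_scale (GC b j) (2*ε) hc ξ
  have hFb : ∀ n : ℤ, n ≠ 0 → ‖𝓕 f n‖ ≤ (C * 2^(K+1) * ε^K) * (1/(n:ℝ)^2) := by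
    intro n hn
    have hn1 : (1:ℝ) ≤ |(n:ℝ)| := by exact_mod_cast Int.one_le_abs hn
    have h1 := hdec ((n:ℝ)/(2*ε))
    rw [hF, norm_smul, Real.norm_of_nonneg (by positivity)]
    set Z := ‖𝓕 (GC b j) ((n:ℝ)/(2*ε))‖ with hZ
    have hZ0 : 0 ≤ Z := norm_nonneg _
    rw [abs_div, abs_of_pos hc, div_pow, div_mul_eq_mul_div, div_le_iff₀ (by positivity)] at h1
    have h3 : |(n:ℝ)|^2 ≤ |(n:ℝ)|^(K+2) := pow_le_pow_right₀ hn1 (by omega)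
    have h4 : |(n:ℝ)|^2 * Z ≤ C * (2*ε)^(K+2) := le_trans (by gcongr) h1
    rw [sq_abs] at h4
    have hn2 : 0 < (n:ℝ)^2 := by positivity
    rw [mul_one_div, le_div_iff₀ hn2, mul_assoc, inv_mul_le_iff₀ hc]
    calc Z * (n:ℝ)^2 ≤ C * (2*ε)^(K+2) := by linarith
      _ = (2 * ε) * (C * 2^(K+1) * ε^K) * ε := by rw [mul_pow]; ring
      _ ≤ (2 * ε) * (C * 2^(K+1) * ε^K) * 1 := by gcongr
      _ = _ := by ring
  have hFs : Summable (fun n : ℤ => 𝓕 f n) := by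
    refine Summable.of_norm_bounded_eventually (g := fun n : ℤ => (C * 2^(K+1) * ε^K) * (1/(n:ℝ)^2)) (hs2.mul_left _) ?_
    filter_upwards [(Set.finite_singleton (0:ℤ)).compl_mem_cofinite] with n hn
    exact hFb n hn
  have P := Real.tsum_eq_tsum_fourier_of_rpow_decay_of_summable hcont (by norm_num : (1:ℝ) < 2) hfO hFs ((p:ℝ)/2)
  have hnf : ∀ n : ℤ, ‖(fourier n (((p:ℝ)/2 : ℝ) : UnitAddCircle) : ℂ)‖ = 1 := fun n => by
    rw [fourier_apply]; exact Circle.norm_coe _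
  have hs3 : Summable (fun n : ℤ => 𝓕 f n * fourier n (((p:ℝ)/2 : ℝ) : UnitAddCircle)) := by
    refine Summable.of_norm ?_
    simp only [norm_mul, hnf, mul_one]
    exact hFs.norm
  rw [hs3.tsum_eq_add_tsum_ite 0] at P
  have e0 : 𝓕 f ((0:ℤ):ℝ) * fourier 0 (((p:ℝ)/2 : ℝ) : UnitAddCircle) = ((1/(2*ε) * ∫ y, Gf b j y : ℝ) : ℂ) := by
    rw [fourier_zero, mul_one, hF, Int.cast_zero, zero_div, Real.fourier_real_eq]
    simp only [mul_zero, neg_zero, AddChar.map_zero_eq_one, one_smul]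
    have : ∫ v, GC b j v = ((∫ y, Gf b j y : ℝ) : ℂ) := integral_ofReal
    rw [this]
    simp
  rw [e0] at P
  have eL : ∑' n : ℤ, f ((p:ℝ)/2 + n) = ((∑' i : ℕ, Gf b j (ε * ((2*i+p : ℕ):ℝ)) : ℝ) : ℂ) := by
    rw [Complex.ofReal_tsum]
    have inj : Function.Injective (fun i : ℕ => (i:ℤ)) := Nat.cast_injective
    rw [← inj.tsum_eq (f := fun n : ℤ => f ((p:ℝ)/2 + n))]
    · congr 1; ext i
      simp only [hf, GC]
      congr 2; push_cast; ring
    · intro n hn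
      by_contra hcon
      have hneg : n < 0 := by
        by_contra h0
        exact hcon ⟨n.toNat, Int.toNat_of_nonneg (by omega)⟩
      apply hn
      simp only [hf, GC]
      rw [Gf_nonpos, Complex.ofReal_zero]
      have h1 : (n:ℝ) ≤ -1 := by exact_mod_cast (by omega : n ≤ -1)
      have h2 : (p:ℝ) ≤ 2 := by exact_mod_cast (by omega : p ≤ 2)
      have : (p:ℝ)/2 + n ≤ 0 := by linarith
      exact mul_nonpos_of_nonneg_of_nonpos hc.le this
  rw [eL] at P
  have hdiff : ((∑' i : ℕ, Gf b j (ε * ((2*i+p : ℕ):ℝ)) - 1/(2*ε) * ∫ y, Gf b j y : ℝ) : ℂ) =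
     ∑' n : ℤ, if n = 0 then 0 else 𝓕 f n * fourier n (((p:ℝ)/2 : ℝ) : UnitAddCircle) := by
    rw [Complex.ofReal_sub, P]; ring
  rw [← Real.norm_eq_abs, ← Complex.norm_real, hdiff]
  refine (tsum_of_norm_bounded (hs2.hasSum.mul_left (C * 2^(K+1) * ε^K)) fun n => ?_).trans ?_
  · by_cases hn : n = 0
    · simp [hn]
    · rw [if_neg hn, norm_mul, hnf, mul_one]
      exact hFb n hn
  · have : 0 ≤ ε^K := by positivity
    nlinarith

lemma Gf_summable (b j : ℕ) (ε : ℝ) (hε : 0 < ε) (p : ℕ) (hp : 1 ≤ p) : Summable (fun i : ℕ => Gf b j (ε * ((2*i+p : ℕ):ℝ))) := by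
  obtain ⟨B, hB, hbd⟩ := Gf_bound b j
  refine Summable.of_norm_bounded (g := fun i : ℕ => (B / ε^2) * (1/(2*(i:ℝ)+1)^2)) (summable_od.mul_left _) fun i => ?_
  refine ((hbd _).2).trans ?_
  have hp1 : (1:ℝ) ≤ p := by exact_mod_cast hp
  rw [div_mul_eq_mul_div, ← mul_div]
  gcongr
  rw [inv_eq_one_div, div_div]
  apply one_div_le_one_div_of_le (by positivity)
  push_cast
  calc (2*(i:ℝ)+1)^2 * ε^2 ≤ (2*(i:ℝ)+p)^2 * ε^2 := by gcongr
    _ ≤ _ := by rw [mul_pow]; linarith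
end Part6

section Part7
open Real MeasureTheory

lemma thm_le (t : ℝ) (ht : 0 < t) (k : ℕ) :
    ∑ i ∈ Finset.range (2*k), (-1:ℝ)^i * (1/(2*(i:ℝ)+1) * exp (-(2*(i:ℝ)+1)^2*t)) ≤ thm t ∧
    thm t ≤ ∑ i ∈ Finset.range (2*k+1), (-1:ℝ)^i * (1/(2*(i:ℝ)+1) * exp (-(2*(i:ℝ)+1)^2*t)) := by
  have ha : Antitone (fun i : ℕ => (1/(2*(i:ℝ)+1) * exp (-(2*(i:ℝ)+1)^2*t))) := by
    intro i j hij
    have hij' : (i:ℝ) ≤ j := by exact_mod_cast hij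
    have h0 : (0:ℝ) ≤ i := by positivity
    apply mul_le_mul
    · apply one_div_le_one_div_of_le (by positivity); linarith
    · apply exp_le_exp.mpr
      have : (2*(i:ℝ)+1)^2 ≤ (2*(j:ℝ)+1)^2 := by gcongr
      nlinarith
    · positivity
    · positivity
  have ht : Filter.Tendsto (fun n => ∑ i ∈ Finset.range n, (-1:ℝ)^i * (1/(2*(i:ℝ)+1) * exp (-(2*(i:ℝ)+1)^2*t))) Filter.atTop (nhds (thm t)) := by
    have := (thm_summable t ht).hasSum.tendsto_sum_nat
    refine this.congr fun n => Finset.sum_congr rfl fun i _ => ?_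
    ring
  exact ⟨ha.alternating_series_le_tendsto ht k, ha.tendsto_le_alternating_series ht k⟩

lemma thm_tendsto : Filter.Tendsto thm (nhdsWithin 0 (Set.Ioi 0)) (nhds (π/4)) := by
  set S : ℕ → ℝ → ℝ := fun n t => ∑ i ∈ Finset.range n, (-1:ℝ)^i * (1/(2*(i:ℝ)+1) * exp (-(2*(i:ℝ)+1)^2*t)) with hS
  have hc : ∀ n, Filter.Tendsto (S n) (nhdsWithin 0 (Set.Ioi 0)) (nhds (S n 0)) := fun n => by
    have : Continuous (S n) := by rw [hS]; fun_prop
    exact this.continuousAt.tendsto.mono_left nhdsWithin_le_nhds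
  have h0 : Filter.Tendsto (fun n => S n 0) Filter.atTop (nhds (π/4)) := by
    refine Real.tendsto_sum_pi_div_four.congr fun n => Finset.sum_congr rfl fun i _ => ?_
    simp [div_eq_mul_inv]
  rw [tendsto_order]
  constructor
  · intro a ha
    have h1 : Filter.Tendsto (fun k : ℕ => S (2*k) 0) Filter.atTop (nhds (π/4)) :=
      h0.comp (Filter.tendsto_atTop_mono (fun k => by omega : ∀ k, k ≤ 2*k) Filter.tendsto_id)
    obtain ⟨k, hk⟩ := (h1.eventually (lt_mem_nhds ha)).exists
    filter_upwards [(hc (2*k)).eventually (lt_mem_nhds hk), self_mem_nhdsWithin] with t h2 ht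
    exact lt_of_lt_of_le h2 (thm_le t ht k).1
  · intro a ha
    have h1 : Filter.Tendsto (fun k : ℕ => S (2*k+1) 0) Filter.atTop (nhds (π/4)) :=
      h0.comp (Filter.tendsto_atTop_mono (fun k => by omega : ∀ k, k ≤ 2*k+1) Filter.tendsto_id)
    obtain ⟨k, hk⟩ := (h1.eventually (gt_mem_nhds ha)).exists
    filter_upwards [(hc (2*k+1)).eventually (gt_mem_nhds hk), self_mem_nhdsWithin] with t h2 ht
    exact lt_of_le_of_lt (thm_le t ht k).2 h2

lemma Gf_integral_Ioi (b j : ℕ) : ∫ y, Gf b j y = ∫ y in Set.Ioi (0:ℝ), Gf b j y := by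
  rw [← integral_indicator measurableSet_Ioi]
  congr 1; ext y
  by_cases hy : 0 < y
  · rw [Set.indicator_of_mem (by exact hy)]
  · rw [Set.indicator_of_notMem (by exact hy), Gf_nonpos _ _ _ (not_lt.mp hy)]

lemma moment_1 : ∫ y, Gf 1 0 y = π/4 := by
  rw [Gf_integral_Ioi]
  set f : ℝ → ℝ := fun y => if 0 < y then - thm (y^2/2) else -(π/4) with hf
  have hsq : Filter.Tendsto (fun y : ℝ => y^2/2) (nhdsWithin 0 (Set.Ioi 0)) (nhdsWithin 0 (Set.Ioi 0)) := by
    apply tendsto_nhdsWithin_iff.mpr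
    constructor
    · have : Continuous (fun y : ℝ => y^2/2) := by fun_prop
      have h := this.continuousAt.tendsto (x := 0)
      simp only [ne_eq, OfNat.ofNat_ne_zero, not_false_eq_true, zero_pow, zero_div] at h
      exact h.mono_left nhdsWithin_le_nhds
    · filter_upwards [self_mem_nhdsWithin] with y hy
      have : (0:ℝ) < y := hy
      exact (by positivity : 0 < y^2/2)
  have h := integral_Ioi_of_hasDerivAt_of_tendsto (f := f) (f' := Gf 1 0) (a := 0) (m := 0) ?_ ?_ (Gf_integrable 1 0).integrableOn ?_
  · rw [h]; simp [hf]
  · rw [← continuousWithinAt_Ioi_iff_Ici]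
    have e : f 0 = -(π/4) := by simp [hf]
    rw [ContinuousWithinAt, e]
    refine ((thm_tendsto.comp hsq).neg).congr' ?_
    filter_upwards [self_mem_nhdsWithin] with y hy
    have hy : (0:ℝ) < y := hy
    simp [hf, hy]
  · intro y hy
    have hy : (0:ℝ) < y := hy
    rw [Gf_pos _ _ y hy]
    have h1 : HasDerivAt (fun z : ℝ => z^2/2) y y := by
      have := ((hasDerivAt_pow 2 y).div_const 2)
      refine this.congr_deriv ?_
      norm_num
    have h2 := ((thm_hasDeriv (y^2/2) (by positivity)).comp y h1).neg
    refine (h2.congr_of_eventuallyEq ?_).congr_deriv ?_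
    · filter_upwards [lt_mem_nhds hy] with z hz
      simp [hf, hz]
    · ring
  · obtain ⟨C, hC, hb⟩ := thm_crude
    have hT : Filter.Tendsto (fun y : ℝ => 4 * C * (y^4)⁻¹) Filter.atTop (nhds 0) := by
      have := (tendsto_pow_neg_atTop (𝕜 := ℝ) (n := 4) (by norm_num)).const_mul (4*C)
      rw [mul_zero] at this
      refine this.congr fun y => ?_
      norm_cast
    refine squeeze_zero_norm' ?_ hT
    filter_upwards [Filter.eventually_gt_atTop 0] with y hy
    simp only [hf, if_pos hy, norm_neg, Real.norm_eq_abs]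
    refine (hb (y^2/2) (by positivity)).trans ?_
    calc C * exp (-(y^2/2)/2) / (y^2/2)^2 ≤ C * 1 / (y^2/2)^2 := by
          gcongr
          apply exp_le_one_iff.mpr
          have : 0 < y^2 := by positivity
          linarith
      _ = _ := by field_simp; ring

lemma gauss2 (c : ℝ) (hc : 0 < c) : ∫ y in Set.Ioi (0:ℝ), y^2 * exp (-c^2*(y^2/2)) = √(π/2) / c^3 := by
  have h := integral_rpow_mul_exp_neg_mul_rpow (p := 2) (q := 2) (b := c^2/2) (by norm_num) (by norm_num) (by positivity)
  have e : ∀ y : ℝ, y^2 * exp (-c^2*(y^2/2)) = y^(2:ℝ) * exp (-(c^2/2) * y^(2:ℝ)) := fun y => by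
    rw [Real.rpow_two]; congr 2; ring
  simp_rw [e]
  rw [h, show ((2:ℝ)+1)/2 = 1/2+1 by norm_num, Real.Gamma_add_one (by norm_num), Real.Gamma_one_half_eq]
  have e2 : (c^2/2)^(-((2:ℝ)+1)/2) = 2 * √2 / c^3 := by
    rw [show -((2:ℝ)+1)/2 = -(3/2) by norm_num, Real.rpow_neg (by positivity), show (c^2/2) = (c/√2)^(2:ℝ) by rw [Real.rpow_two, div_pow, Real.sq_sqrt (by norm_num)],
      ← Real.rpow_mul (by positivity), show (2:ℝ)*(3/2) = (3:ℕ) by norm_num, Real.rpow_natCast, div_pow, inv_div]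
    congr 1
    rw [pow_succ, Real.sq_sqrt (by norm_num)]
  rw [e2, Real.sqrt_div (by positivity)]
  have : √2 ≠ 0 := by positivity
  have h2 : √2 * √2 = 2 := Real.mul_self_sqrt (by norm_num)
  field_simp
  nlinarith

lemma gauss2_int (c : ℝ) (hc : 0 < c) : IntegrableOn (fun y : ℝ => y^2 * exp (-c^2*(y^2/2))) (Set.Ioi (0:ℝ)) := by
  have h := integrableOn_rpow_mul_exp_neg_mul_rpow (p := 2) (s := 2) (b := c^2/2) (by norm_num) (by norm_num) (by positivity)
  refine h.congr_fun (fun y _ => ?_) measurableSet_Ioi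
  simp only [Real.rpow_two]; congr 2; ring

lemma moment_2 : ∫ y, Gf 2 0 y = catalanG * √(π/2) := by
  rw [Gf_integral_Ioi]
  have hs := hasSum_integral_of_summable_integral_norm (μ := volume.restrict (Set.Ioi (0:ℝ)))
    (F := fun (l : ℕ) (y : ℝ) => ((-1:ℝ)^l * (2*(l:ℝ)+1)) * (y^2 * exp (-(2*(l:ℝ)+1)^2*(y^2/2)))) ?_ ?_
  · have e1 : ∀ l : ℕ, ∫ y in Set.Ioi (0:ℝ), ((-1:ℝ)^l * (2*(l:ℝ)+1)) * (y^2 * exp (-(2*(l:ℝ)+1)^2*(y^2/2))) = (-1:ℝ)^l/(2*(l:ℝ)+1)^2 * √(π/2) := by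
      intro l
      rw [integral_const_mul, gauss2 _ (by positivity)]
      field_simp
    simp_rw [e1] at hs
    rw [catalanG, ← tsum_mul_right, hs.tsum_eq]
    refine setIntegral_congr_fun measurableSet_Ioi fun y hy => ?_
    have hy : (0:ℝ) < y := hy
    rw [Gf_pos _ _ _ hy, th, ← tsum_mul_left]
    congr 1; ext l
    ring
  · intro l
    exact (gauss2_int _ (by positivity)).const_mul _
  · have e2 : ∀ l : ℕ, ∫ y in Set.Ioi (0:ℝ), ‖((-1:ℝ)^l * (2*(l:ℝ)+1)) * (y^2 * exp (-(2*(l:ℝ)+1)^2*(y^2/2)))‖ = √(π/2) * (1/(2*(l:ℝ)+1)^2) := by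
      intro l
      have : ∀ y : ℝ, ‖((-1:ℝ)^l * (2*(l:ℝ)+1)) * (y^2 * exp (-(2*(l:ℝ)+1)^2*(y^2/2)))‖ = (2*(l:ℝ)+1) * (y^2 * exp (-(2*(l:ℝ)+1)^2*(y^2/2))) := by
        intro y
        rw [norm_mul, norm_mul, norm_pow, norm_neg, norm_one, one_pow, one_mul, Real.norm_of_nonneg (by positivity), Real.norm_of_nonneg (by positivity)]
      simp_rw [this]
      rw [integral_const_mul, gauss2 _ (by positivity)]
      field_simp
    simp_rw [e2]
    exact summable_od.mul_left _

/-- moment numbers -/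
def mom (q : ℕ) : ℕ → ℕ
  | 0 => 1
  | k+1 => (2*k+2+q) * mom q k

lemma moment_gen (q k : ℕ) : ∫ y, Gf (2*k+1+q) k y = mom q k * ∫ y, Gf (1+q) 0 y := by
  induction k with
  | zero => simp [mom]
  | succ k ih =>
    have := Gf_moment (2*k+2+q) k
    rw [show 2*(k+1)+1+q = 2*k+2+q+1 by ring, this, show 2*k+2+q-1 = 2*k+1+q by omega, ih, mom]
    push_cast; ring
end Part7

section Part8
open Real MeasureTheory

lemma pe_bound (m : ℕ) : ∃ C > (0:ℝ), ∀ s : ℝ, 0 ≤ s → (1+s)^m * exp (-s/2) ≤ C := by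
  refine ⟨2^m * (m.factorial:ℝ) * exp (1/2), by positivity, fun s hs => ?_⟩
  have h := Real.pow_div_factorial_le_exp ((1+s)/2) (by positivity) m
  rw [div_le_iff₀ (by positivity), div_pow, div_le_iff₀ (by positivity)] at h
  calc (1+s)^m * exp (-s/2) ≤ (exp ((1 + s) / 2) * ↑m.factorial * 2 ^ m) * exp (-s/2) := by gcongr
    _ = 2^m * (m.factorial:ℝ) * (exp ((1 + s) / 2) * exp (-s/2)) := by ring
    _ = _ := by rw [← exp_add]; congr 2; ring

/-- the summand -/
noncomputable def Tt (q M p : ℕ) (κ : ℝ) (i l : ℕ) : ℝ :=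
  (-1:ℝ)^l * (√(1/((M:ℝ)+1)) * ((2*i+p : ℕ):ℝ))^q * (√(1/((M:ℝ)+1)) * (((2*l+1)*(2*i+p) : ℕ):ℝ))
    * ((binN M ((2*l+1)*(2*i+p)) : ℝ)/κ)

noncomputable def Tmain (q M p : ℕ) (i l : ℕ) : ℝ :=
  (-1:ℝ)^l * (√(1/((M:ℝ)+1)) * ((2*i+p : ℕ):ℝ))^q * (√(1/((M:ℝ)+1)) * (((2*l+1)*(2*i+p) : ℕ):ℝ))
    * (exp (-((((2*l+1)*(2*i+p) : ℕ):ℝ)^2 * (1/((M:ℝ)+1)))/2) * Qf ((((2*l+1)*(2*i+p) : ℕ):ℝ)^2 * (1/((M:ℝ)+1))) (1/((M:ℝ)+1)))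

lemma Tmain_hasSum (q M p i : ℕ) (hp : 1 ≤ p) :
    HasSum (Tmain q M p i) (∑ k ∈ Finset.range 9, qc (1/((M:ℝ)+1)) k * Gf (2*k+1+q) k (√(1/((M:ℝ)+1)) * ((2*i+p : ℕ):ℝ))) := by
  have ha : (0:ℝ) < 1/((M:ℝ)+1) := by positivity
  set a := 1/((M:ℝ)+1) with hadef
  have hε : 0 < √a := Real.sqrt_pos.2 ha
  have hsq : √a^2 = a := Real.sq_sqrt ha.le
  have hh : (0:ℝ) < ((2*i+p : ℕ):ℝ) := by
    have : 0 < 2*i+p := by omega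
    exact_mod_cast this
  set y := √a * ((2*i+p : ℕ):ℝ) with hy
  have hy0 : 0 < y := by positivity
  have key : HasSum (fun l : ℕ => ∑ k ∈ Finset.range 9, qc a k * (y^(2*k+1+q) * ((-1)^l * (2*(l:ℝ)+1)^(2*k+1) * exp (-(2*(l:ℝ)+1)^2 * (y^2/2)))))
      (∑ k ∈ Finset.range 9, qc a k * Gf (2*k+1+q) k y) := by
    refine hasSum_sum fun k _ => ?_
    rw [Gf_pos _ _ _ hy0]
    exact ((th_summable k (y^2/2) (by positivity)).hasSum.mul_left _).mul_left _
  convert key using 1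
  ext l
  have e1 : (((2*l+1)*(2*i+p) : ℕ):ℝ) = (2*(l:ℝ)+1) * ((2*i+p : ℕ):ℝ) := by push_cast; ring
  have e2 : (((2*l+1)*(2*i+p) : ℕ):ℝ)^2 * a = (2*(l:ℝ)+1)^2 * y^2 := by
    rw [e1, hy, mul_pow, mul_pow, hsq]; ring
  have e3 : √a * (((2*l+1)*(2*i+p) : ℕ):ℝ) = (2*(l:ℝ)+1) * y := by rw [e1, hy]; ring
  rw [Tmain, ← hadef, ← hy, e2, e3, Qf, Finset.mul_sum, Finset.mul_sum]
  refine Finset.sum_congr rfl fun k _ => ?_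
  rw [show -((2*(l:ℝ)+1)^2 * y^2)/2 = -(2*(l:ℝ)+1)^2 * (y^2/2) by ring, mul_pow ((2*(l:ℝ)+1)^2)]
  generalize (2*(l:ℝ)+1) = c
  generalize exp (-c^2 * (y^2/2)) = e
  ring

lemma T_diff (q : ℕ) (hq : q ≤ 1) (C0 : ℝ) (hC0 : 0 < C0) (K : ℕ) : ∃ C > (0:ℝ), ∀ M : ℕ, ∀ κ > (0:ℝ),
    (∀ x : ℕ, (M+x)%2 = 0 → |(binN M x : ℝ)/κ - exp (-((x:ℝ)^2 * (1/((M:ℝ)+1)))/2) * Qf ((x:ℝ)^2 * (1/((M:ℝ)+1))) (1/((M:ℝ)+1))| ≤ C0 * (1/((M:ℝ)+1))^5 * (1 + (x:ℝ)^2 * (1/((M:ℝ)+1)))^K * exp (-((x:ℝ)^2 * (1/((M:ℝ)+1)))/2)) →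
    ∀ p : ℕ, 1 ≤ p → (M+p)%2 = 0 → ∀ i l : ℕ, |Tt q M p κ i l - Tmain q M p i l| ≤
      C * (1/((M:ℝ)+1))^4 * ((1/(2*(l:ℝ)+1)^2) * (1/(2*(i:ℝ)+1)^2)) := by
  obtain ⟨C1, hC1, hb⟩ := pe_bound (K+2)
  refine ⟨C0 * C1, by positivity, fun M κ hκ hyp p hp hpar i l => ?_⟩
  have ha : (0:ℝ) < 1/((M:ℝ)+1) := by positivity
  have hpar2 : (M + (2*l+1)*(2*i+p))%2 = 0 := by
    have : M + (2*l+1)*(2*i+p) = (M+p) + 2*(l*(2*i+p)+i) := by ring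
    rw [this]; omega
  have hx := hyp _ hpar2
  set a := 1/((M:ℝ)+1) with hadef
  have hε : 0 < √a := Real.sqrt_pos.2 ha
  have hsq : √a^2 = a := Real.sq_sqrt ha.le
  have e1 : (((2*l+1)*(2*i+p) : ℕ):ℝ) = (2*(l:ℝ)+1) * ((2*i+p : ℕ):ℝ) := by push_cast; ring
  have hp' : (1:ℝ) ≤ p := by exact_mod_cast hp
  have hh : 2*(i:ℝ)+1 ≤ ((2*i+p : ℕ):ℝ) := by push_cast; linarith
  set x : ℕ := (2*l+1)*(2*i+p) with hxd
  set u := √a * (x:ℝ) with hu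
  have hl : (1:ℝ) ≤ 2*(l:ℝ)+1 := od_ge l
  have hi : (1:ℝ) ≤ 2*(i:ℝ)+1 := od_ge i
  have hxp : (2*(l:ℝ)+1) * (2*(i:ℝ)+1) ≤ x := by rw [e1]; gcongr
  have hx0 : (0:ℝ) < x := by nlinarith
  have hu0 : 0 < u := by positivity
  have hs : (x:ℝ)^2 * a = u^2 := by rw [hu, mul_pow, hsq]; ring
  have hyu : √a * ((2*i+p : ℕ):ℝ) ≤ u := by
    rw [hu, e1]; gcongr
    nlinarith
  have hy0 : 0 ≤ √a * ((2*i+p : ℕ):ℝ) := by positivity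
  have hqu : (√a * ((2*i+p : ℕ):ℝ))^q * u ≤ 1 + u^2 := by
    interval_cases q
    · simp; nlinarith [sq_nonneg (u-1)]
    · simp only [pow_one]; nlinarith
  rw [hs] at hx
  have hb' := hb (u^2) (by positivity)
  rw [Tt, Tmain, ← hadef, ← hxd, ← hu, hs, ← mul_sub, abs_mul, abs_mul, abs_mul, abs_pow, abs_neg, abs_one, one_pow, one_mul,
    abs_of_pos hu0, abs_of_nonneg (by positivity : (0:ℝ) ≤ (√a * ((2*i+p : ℕ):ℝ))^q)]
  calc (√a * ((2*i+p : ℕ):ℝ))^q * u * |(binN M x:ℝ)/κ - exp (-u^2/2) * Qf (u^2) a|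
      ≤ (1+u^2) * (C0 * a^5 * (1+u^2)^K * exp (-u^2/2)) := by
        gcongr
    _ ≤ C0 * a^5 * ((1+u^2)^(K+2) * exp (-u^2/2)) * (1/u^2) := by
        rw [mul_one_div, le_div_iff₀ (by positivity)]
        have : u^2 ≤ 1 + u^2 := by linarith
        calc _ ≤ (1+u^2) * (C0 * a^5 * (1+u^2)^K * exp (-u^2/2)) * (1+u^2) := by gcongr
          _ = _ := by ring
    _ ≤ C0 * a^5 * C1 * (1/u^2) := by gcongr
    _ = C0 * C1 * a^4 * (1/(x:ℝ)^2) := by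
        rw [← hs]; field_simp
    _ ≤ C0 * C1 * a^4 * (1/((2*(l:ℝ)+1) * (2*(i:ℝ)+1))^2) := by gcongr
    _ = _ := by rw [mul_pow]; field_simp

lemma qc_bdd : ∃ B > (0:ℝ), ∀ a : ℝ, 0 < a → a ≤ 1 → ∀ k ∈ Finset.range 9, |qc a k| ≤ B := by
  have hc : ∀ k ∈ Finset.range 9, ContinuousOn (fun a => qc a k) (Set.Icc 0 1) := by
    intro k hk
    have : k < 9 := by simpa using hk
    interval_cases k <;> (simp only [qc]; fun_prop)
  have : ∀ k ∈ Finset.range 9, ∃ B, ∀ a ∈ Set.Icc (0:ℝ) 1, |qc a k| ≤ B := fun k hk => by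
    obtain ⟨B, hB⟩ := isCompact_Icc.exists_bound_of_continuousOn (hc k hk)
    exact ⟨B, hB⟩
  choose! B hB using this
  refine ⟨1 + ∑ k ∈ Finset.range 9, |B k|, by positivity, fun a h0 h1 k hk => ?_⟩
  have h2 := hB k hk a ⟨h0.le, h1⟩
  have h3 := Finset.single_le_sum (f := fun k => |B k|) (fun _ _ => abs_nonneg _) hk
  have h4 := le_abs_self (B k)
  linarith

lemma X_asymp (q : ℕ) (hq : q ≤ 1) (C0 : ℝ) (hC0 : 0 < C0) (K : ℕ) : ∃ C > (0:ℝ), ∀ M : ℕ, ∀ κ > (0:ℝ),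
    (∀ x : ℕ, (M+x)%2 = 0 → |(binN M x : ℝ)/κ - exp (-((x:ℝ)^2 * (1/((M:ℝ)+1)))/2) * Qf ((x:ℝ)^2 * (1/((M:ℝ)+1))) (1/((M:ℝ)+1))| ≤ C0 * (1/((M:ℝ)+1))^5 * (1 + (x:ℝ)^2 * (1/((M:ℝ)+1)))^K * exp (-((x:ℝ)^2 * (1/((M:ℝ)+1)))/2)) →
    ∀ p : ℕ, p = 1 ∨ p = 2 → (M+p)%2 = 0 →
     |∑' i, ∑' l, Tt q M p κ i l - 1/(2*√(1/((M:ℝ)+1))) * ((∑ k ∈ Finset.range 9, qc (1/((M:ℝ)+1)) k * mom q k) * ∫ y, Gf (1+q) 0 y)| ≤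
      C * (1/((M:ℝ)+1))^4 := by
  obtain ⟨C1, hC1, hd⟩ := T_diff q hq C0 hC0 K
  obtain ⟨B, hB, hqb⟩ := qc_bdd
  have hP := fun k => poisson_G (2*k+1+q) k 8
  choose D hD hP using hP
  set S : ℝ := ∑' l : ℕ, 1/(2*(l:ℝ)+1)^2 with hS
  have hS0 : 0 ≤ S := tsum_nonneg fun l => by positivity
  refine ⟨C1 * S * S + ∑ k ∈ Finset.range 9, B * D k, ?_, fun M κ hκ hyp p hp hpar => ?_⟩
  · have : 0 < ∑ k ∈ Finset.range 9, B * D k := Finset.sum_pos (fun k _ => mul_pos hB (hD k)) ⟨0, by simp⟩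
    positivity
  have hp1 : 1 ≤ p := by omega
  have hd' := hd M κ hκ hyp p hp1 hpar
  have hM := fun i => Tmain_hasSum q M p i hp1
  have ha : (0:ℝ) < 1/((M:ℝ)+1) := by positivity
  have ha1 : 1/((M:ℝ)+1) ≤ 1 := by
    rw [div_le_one (by positivity)]; linarith [(Nat.cast_nonneg M : (0:ℝ) ≤ M)]
  set a := 1/((M:ℝ)+1) with hadef
  have hε : 0 < √a := Real.sqrt_pos.2 ha
  have hε1 : √a ≤ 1 := Real.sqrt_le_one.2 ha1
  have hsq : √a^2 = a := Real.sq_sqrt ha.le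
  have hdom : ∀ i : ℕ, Summable (fun l : ℕ => C1 * a^4 * ((1/(2*(l:ℝ)+1)^2) * (1/(2*(i:ℝ)+1)^2))) := fun i =>
    (summable_od.mul_right _).mul_left _
  have hEs : ∀ i, Summable (fun l => Tt q M p κ i l - Tmain q M p i l) := fun i =>
    Summable.of_norm_bounded (hdom i) (hd' i)
  have hEb : ∀ i, |∑' l, (Tt q M p κ i l - Tmain q M p i l)| ≤ C1 * a^4 * S * (1/(2*(i:ℝ)+1)^2) := by
    intro i
    have := tsum_of_norm_bounded (f := fun l => Tt q M p κ i l - Tmain q M p i l) (hdom i).hasSum (hd' i)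
    rw [Real.norm_eq_abs] at this
    refine this.trans (le_of_eq ?_)
    rw [tsum_mul_left, tsum_mul_right]; ring
  have hT : ∀ i, ∑' l, Tt q M p κ i l = ∑' l, (Tt q M p κ i l - Tmain q M p i l) + ∑ k ∈ Finset.range 9, qc a k * Gf (2*k+1+q) k (√a * ((2*i+p : ℕ):ℝ)) := by
    intro i
    have := ((hEs i).hasSum.add (hM i)).tsum_eq
    rw [← this]
    congr 1; ext l; ring
  have hdom2 : Summable (fun i : ℕ => C1 * a^4 * S * (1/(2*(i:ℝ)+1)^2)) := summable_od.mul_left _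
  have hE2 : Summable (fun i => ∑' l, (Tt q M p κ i l - Tmain q M p i l)) := Summable.of_norm_bounded hdom2 hEb
  have hE2b : |∑' i, ∑' l, (Tt q M p κ i l - Tmain q M p i l)| ≤ C1 * S * S * a^4 := by
    have := tsum_of_norm_bounded (f := fun i => ∑' l, (Tt q M p κ i l - Tmain q M p i l)) hdom2.hasSum hEb
    rw [Real.norm_eq_abs] at this
    refine this.trans (le_of_eq ?_)
    rw [tsum_mul_left]; ring
  have hG : HasSum (fun i => ∑ k ∈ Finset.range 9, qc a k * Gf (2*k+1+q) k (√a * ((2*i+p : ℕ):ℝ))) (∑ k ∈ Finset.range 9, qc a k * ∑' i : ℕ, Gf (2*k+1+q) k (√a * ((2*i+p : ℕ):ℝ))) :=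
    hasSum_sum fun k _ => (Gf_summable _ _ _ hε p hp1).hasSum.mul_left _
  have hfin : ∑' i, ∑' l, Tt q M p κ i l = ∑' i, ∑' l, (Tt q M p κ i l - Tmain q M p i l) + ∑ k ∈ Finset.range 9, qc a k * ∑' i : ℕ, Gf (2*k+1+q) k (√a * ((2*i+p : ℕ):ℝ)) := by
    rw [← (hE2.hasSum.add hG).tsum_eq]
    congr 1; ext i; exact hT i
  have hmain : |∑ k ∈ Finset.range 9, qc a k * ∑' i : ℕ, Gf (2*k+1+q) k (√a * ((2*i+p : ℕ):ℝ)) - 1/(2*√a) * ((∑ k ∈ Finset.range 9, qc a k * mom q k) * ∫ y, Gf (1+q) 0 y)| ≤ (∑ k ∈ Finset.range 9, B * D k) * a^4 := by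
    rw [Finset.sum_mul, Finset.mul_sum, ← Finset.sum_sub_distrib, Finset.sum_mul]
    refine (Finset.abs_sum_le_sum_abs _ _).trans (Finset.sum_le_sum fun k hk => ?_)
    have h1 := hP k (√a) hε hε1 p hp
    rw [moment_gen, show √a^8 = a^4 by rw [← hsq, ← pow_mul]; norm_num [hsq]] at h1
    have h2 := hqb a ha ha1 k hk
    have h3 : qc a k * ∑' i : ℕ, Gf (2*k+1+q) k (√a * ((2*i+p : ℕ):ℝ)) - 1/(2*√a) * (qc a k * mom q k * ∫ y, Gf (1+q) 0 y) = qc a k * (∑' i : ℕ, Gf (2*k+1+q) k (√a * ((2*i+p : ℕ):ℝ)) - 1/(2*√a) * (mom q k * ∫ y, Gf (1+q) 0 y)) := by ring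
    rw [h3, abs_mul, mul_assoc]
    gcongr
  rw [hfin, add_sub_assoc, add_mul]
  exact (abs_add_le _ _).trans (add_le_add hE2b hmain)
end Part8

section Part9
open Real MeasureTheory

lemma V_zero_par (n h : ℕ) (hn : 1 ≤ n) (hp : (n+1+(h+1))%2 = 1) : (V n h:ℝ) = 0 := by
  obtain ⟨_, h2⟩ := V_formula n h hn
  have : ∀ l : ℕ, (-1:ℝ)^l * (((2*l+1)*(h+1):ℕ):ℝ) * binN (n+1) ((2*l+1)*(h+1)) = 0 := by
    intro l
    have : (n+1+(2*l+1)*(h+1))%2 = 1 := by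
      have : n+1+(2*l+1)*(h+1) = (n+1+(h+1)) + 2*(l*(h+1)) := by ring
      rw [this]; omega
    rw [binN, if_neg (by omega)]; simp
  simp_rw [this] at h2
  rw [tsum_zero, mul_zero] at h2
  have h3 : (n:ℝ)+1 ≠ 0 := by positivity
  exact (mul_eq_zero.1 h2).resolve_left h3

lemma V_zero_big (n h : ℕ) (hn : 1 ≤ n) (hp : n < h) : (V n h:ℝ) = 0 := by
  obtain ⟨_, h2⟩ := V_formula n h hn
  have : ∀ l : ℕ, (-1:ℝ)^l * (((2*l+1)*(h+1):ℕ):ℝ) * binN (n+1) ((2*l+1)*(h+1)) = 0 := by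
    intro l
    rw [binN_zero _ _ (by nlinarith)]; simp
  simp_rw [this] at h2
  rw [tsum_zero, mul_zero] at h2
  have h3 : (n:ℝ)+1 ≠ 0 := by positivity
  exact (mul_eq_zero.1 h2).resolve_left h3

lemma VV_summable (n : ℕ) (hn : 1 ≤ n) (f : ℕ → ℝ) : Summable (fun h => f h * (V n h : ℝ)) := by
  refine summable_of_ne_finset_zero (s := Finset.range (n+1)) fun h hh => ?_
  rw [V_zero_big n h hn (by simpa using hh), mul_zero]

lemma X_eq_V (q n p : ℕ) (κ : ℝ) (hn : 1 ≤ n) (hp : p = 1 ∨ p = 2) (hpar : (n+1+p)%2 = 0) :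
    ∑' i, ∑' l, Tt q (n+1) p κ i l = √(1/(((n+1:ℕ):ℝ)+1))^(q+1) * (((n:ℝ)+1)/(2*κ)) * ∑' h : ℕ, ((h:ℝ)+1)^q * (V n h : ℝ) := by
  have hp1 : 1 ≤ p := by omega
  have hinj : Function.Injective (fun i : ℕ => 2*i+p-1) := by
    intro i j hij
    simp only at hij
    omega
  have hre : ∑' i : ℕ, (((2*i+p-1 : ℕ):ℝ)+1)^q * (V n (2*i+p-1) : ℝ) = ∑' h : ℕ, ((h:ℝ)+1)^q * (V n h : ℝ) := by
    refine hinj.tsum_eq (f := fun h : ℕ => ((h:ℝ)+1)^q * (V n h : ℝ)) ?_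
    intro h hh
    rw [Function.mem_support] at hh
    have : (n+1+(h+1))%2 = 0 := by
      by_contra hc
      exact hh (by rw [V_zero_par n h hn (by omega), mul_zero])
    refine ⟨(h+1-p)/2, ?_⟩
    simp only
    omega
  rw [← hre, ← tsum_mul_left]
  congr 1; ext i
  obtain ⟨_, h2⟩ := V_formula n (2*i+p-1) hn
  have e0 : 2*i+p-1+1 = 2*i+p := by omega
  have e1 : (((2*i+p-1 : ℕ):ℝ)+1) = ((2*i+p : ℕ):ℝ) := by exact_mod_cast e0
  rw [e0] at h2
  set ε := √(1/(((n+1:ℕ):ℝ)+1))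
  have e2 : ∀ l, Tt q (n+1) p κ i l = (ε^(q+1) * ((2*i+p : ℕ):ℝ)^q / κ) * ((-1:ℝ)^l * (((2*l+1)*(2*i+p):ℕ):ℝ) * binN (n+1) ((2*l+1)*(2*i+p))) := by
    intro l
    rw [Tt]
    ring
  simp_rw [e2]
  rw [tsum_mul_left, e1]
  have e3 : ∀ A B : ℝ, A = B → A * (1/(2*κ)) = B * (1/(2*κ)) := fun A B h => by rw [h]
  have e4 := e3 _ _ h2
  generalize (∑' l : ℕ, ((-1:ℝ)^l * (((2*l+1)*(2*i+p):ℕ):ℝ) * binN (n+1) ((2*l+1)*(2*i+p)))) = Z at *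
  calc ε^(q+1) * ((2*i+p : ℕ):ℝ)^q / κ * Z = ε^(q+1) * ((2*i+p : ℕ):ℝ)^q * (2 * Z * (1/(2*κ))) := by ring
    _ = _ := by rw [← e4]; ring

noncomputable def dd (a : ℝ) : ℝ := 1 - 2/3*a + a^2/15 + 2/63*a^3 - 4/189*a^4
noncomputable def nn (a : ℝ) : ℝ := 1 - 5/4*a + 9/32*a^2 + 1/128*a^3 - 101/2048*a^4
noncomputable def PP (t : ℝ) : ℝ := 1 + 5*t/12 - 131/1440*t^2 + 1129/24192*t^3

lemma dd_eq (a : ℝ) : ∑ k ∈ Finset.range 9, qc a k * (mom 0 k : ℝ) = dd a := by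
  simp only [Finset.sum_range_succ, Finset.sum_range_zero, qc, mom, dd]
  push_cast
  ring

lemma nn_eq (a : ℝ) : ∑ k ∈ Finset.range 9, qc a k * (mom 1 k : ℝ) = nn a := by
  simp only [Finset.sum_range_succ, Finset.sum_range_zero, qc, mom, nn]
  push_cast
  ring

lemma dd_bd (a : ℝ) (h0 : 0 ≤ a) (h1 : a ≤ 1/2) : 1/2 ≤ dd a ∧ dd a ≤ 2 := by
  have h2 : a^2 ≤ 1/4 := by nlinarith
  have h3 : a^3 ≤ 1/8 := by nlinarith [pow_nonneg h0 2]
  have h4 : a^4 ≤ 1/16 := by nlinarith [pow_nonneg h0 3]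
  have := pow_nonneg h0 2
  have := pow_nonneg h0 3
  have := pow_nonneg h0 4
  unfold dd
  constructor <;> linarith

lemma nn_bd (a : ℝ) (h0 : 0 ≤ a) (h1 : a ≤ 1/2) : 0 ≤ nn a ∧ nn a ≤ 2 := by
  have h2 : a^2 ≤ 1/4 := by nlinarith
  have h3 : a^3 ≤ 1/8 := by nlinarith [pow_nonneg h0 2]
  have h4 : a^4 ≤ 1/16 := by nlinarith [pow_nonneg h0 3]
  have := pow_nonneg h0 2
  have := pow_nonneg h0 3
  have := pow_nonneg h0 4
  unfold nn
  constructor <;> linarith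

noncomputable def RR (t : ℝ) : ℝ := (-964651/14515200)*t^0 + (-18770539/19353600)*t^1 + (-19749115669/3251404800)*t^2 + (-2495953997293/117050572800)*t^3 + (-38576506952725351/842764124160000)*t^4 + (-25763667111096359/421382062080000)*t^5 + (-1129680263727623/23044331520000)*t^6 + (-1088324863789969/51849745920000)*t^7 + (-1233352257336599/362948221440000)*t^8 + (-2518786216333/18147411072000)*t^9 + (-8570238685009/32665339929600)*t^10

lemma ratio_expand : ∃ C > (0:ℝ), ∀ t : ℝ, 0 < t → t ≤ 1/2 →
    |√(1+2*t) * (nn (t/(1+2*t)) / dd (t/(1+2*t))) - PP t| ≤ C * t^4 := by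
  obtain ⟨C, hC⟩ := isCompact_Icc.exists_bound_of_continuousOn (s := Set.Icc (0:ℝ) 1) (f := RR) (by unfold RR; fun_prop)
  refine ⟨4*(|C|+1), by positivity, fun t h0 h1 => ?_⟩
  have hR := hC t ⟨h0.le, by linarith⟩
  rw [Real.norm_eq_abs] at hR
  have hc : (0:ℝ) < 1+2*t := by linarith
  set a := t/(1+2*t) with ha
  have ha0 : 0 ≤ a := by positivity
  have ha1 : a ≤ 1/2 := by rw [ha, div_le_iff₀ hc]; linarith
  obtain ⟨hd1, hd2⟩ := dd_bd a ha0 ha1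
  obtain ⟨hn1, hn2⟩ := nn_bd a ha0 ha1
  set A := √(1+2*t) * (nn a / dd a) with hA
  have hA0 : 0 ≤ A := by positivity
  have hP : 1 ≤ PP t := by
    unfold PP
    have h2 : t^2 ≤ t := by nlinarith
    have := pow_pos h0 3
    linarith
  have hid : (1+2*t) * nn a^2 - PP t^2 * dd a^2 = t^4 * RR t / (1+2*t)^8 := by
    rw [ha]; unfold nn dd PP RR
    field_simp
    ring
  have hsq : A^2 - PP t^2 = (t^4 * RR t / (1+2*t)^8) / dd a^2 := by
    rw [← hid, hA, mul_pow, Real.sq_sqrt hc.le]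
    field_simp
  have h8 : (1:ℝ) ≤ (1+2*t)^8 := one_le_pow₀ (by linarith)
  have hb : |A^2 - PP t^2| ≤ 4*(|C|+1) * t^4 := by
    rw [hsq, abs_div, abs_div, abs_mul, abs_of_pos (pow_pos h0 4), abs_of_pos (by positivity : (0:ℝ) < (1+2*t)^8), abs_of_pos (by positivity : (0:ℝ) < dd a^2)]
    rw [div_le_iff₀ (by positivity), div_le_iff₀ (by positivity)]
    have : (1:ℝ)/4 ≤ dd a^2 := by nlinarith
    calc t^4 * |RR t| ≤ t^4 * (|C|+1) := by gcongr; linarith [le_abs_self C]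
      _ = 4*(|C|+1)*t^4 * (1/4) * 1 := by ring
      _ ≤ _ := by gcongr
  have h9 : A^2 - PP t^2 = (A - PP t) * (A + PP t) := by ring
  rw [h9, abs_mul, abs_of_pos (by linarith : 0 < A + PP t)] at hb
  nlinarith [abs_nonneg (A - PP t)]
end Part9

section Part10
open Real MeasureTheory

lemma ratio_lemma (ε ν d g r0 r1 X0 X1 B0 B1 : ℝ) (hε : 0 < ε) (hd1 : 1/2 ≤ d) (hd2 : d ≤ 2)
    (hn1 : 0 ≤ ν) (hn2 : ν ≤ 2) (hX0 : X0 = 1/(2*ε) * (d * (π/4)) + r0) (hX1 : X1 = 1/(2*ε) * (ν * g) + r1)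
    (hr0 : |r0| ≤ B0) (hr1 : |r1| ≤ B1) (hsm : 2*ε*B0 ≤ π/16) :
    0 < X0 ∧ |X1/(ε*X0) - 4*g/π/ε * (ν/d)| ≤ (π*B1 + 4 * |g| * B0) / (π/16*(π/8)) := by
  have hpi := Real.pi_pos
  have hY0 : 2*ε*X0 = d*(π/4) + 2*ε*r0 := by rw [hX0]; field_simp
  have hY1 : 2*ε*X1 = ν*g + 2*ε*r1 := by rw [hX1]; field_simp
  have hlow : π/16 ≤ 2*ε*X0 := by
    rw [hY0]
    have h1 : -(2*ε*B0) ≤ 2*ε*r0 := by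
      have := neg_le_of_abs_le hr0
      nlinarith
    nlinarith
  have hX0p : 0 < X0 := by
    have : 0 < 2*ε*X0 := by linarith [div_pos hpi (by norm_num : (0:ℝ) < 16)]
    exact pos_of_mul_pos_right this (by positivity)
  refine ⟨hX0p, ?_⟩
  have hd0 : 0 < d := by linarith
  have hdl : π/8 ≤ d*(π/4) := by nlinarith
  have hid : X1/(ε*X0) - 4*g/π/ε * (ν/d) = (2*r1*(d*(π/4)) - 2*(ν*g)*r0) / ((2*ε*X0)*(d*(π/4))) := by
    have h1 : X1/(ε*X0) = (2*ε*X1)/(ε*(2*ε*X0)) := by field_simp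
    rw [h1, hY1]
    have h2 : 2*ε*r0 = 2*ε*X0 - d*(π/4) := by linarith
    have h3 : r0 = (2*ε*X0 - d*(π/4))/(2*ε) := by rw [← h2]; field_simp
    rw [h3]
    field_simp
    ring
  rw [hid, abs_div, abs_of_pos (by positivity : 0 < (2*ε*X0)*(d*(π/4)))]
  have hB0 : 0 ≤ B0 := (abs_nonneg _).trans hr0
  have hB1 : 0 ≤ B1 := (abs_nonneg _).trans hr1
  have hnum : |2*r1*(d*(π/4)) - 2*(ν*g)*r0| ≤ π*B1 + 4 * |g| * B0 := by
    refine (abs_sub _ _).trans (add_le_add ?_ ?_)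
    · rw [abs_mul, abs_mul, abs_of_pos (by positivity : 0 < d*(π/4)), abs_two]
      calc 2 * |r1| * (d*(π/4)) ≤ 2*B1*(2*(π/4)) := by gcongr
        _ = _ := by ring
    · rw [abs_mul, abs_mul, abs_mul, abs_of_nonneg hn1, abs_two]
      calc 2 * (ν * |g|) * |r0| ≤ 2 * (2 * |g|) * B0 := by gcongr
        _ = _ := by ring
  gcongr

lemma target_eq (n : ℝ) (hn : 0 < n) : 2 * catalanG * Real.sqrt (2 * n / π) - 1 +
            5 * Real.sqrt 2 * catalanG / (6 * Real.sqrt (π * n)) -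
            131 * Real.sqrt 2 * catalanG / (720 * Real.sqrt (π * n ^ 3)) +
            1129 * Real.sqrt 2 * catalanG / (12096 * Real.sqrt (π * n ^ 5)) =
      4*(catalanG * √(π/2))/π * √n * PP (1/n) - 1 := by
  have hpi := Real.pi_pos
  have e1 : √(π * n^3) = √π * (n * √n) := by
    rw [Real.sqrt_mul hpi.le, show n^3 = n^2*n by ring, Real.sqrt_mul (by positivity), Real.sqrt_sq hn.le]
  have e2 : √(π * n^5) = √π * (n^2 * √n) := by
    rw [Real.sqrt_mul hpi.le, show n^5 = (n^2)^2*n by ring, Real.sqrt_mul (by positivity), Real.sqrt_sq (by positivity)]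
  have e3 : √(2*n/π) = √2 * √n / √π := by
    rw [Real.sqrt_div (by positivity), Real.sqrt_mul (by positivity)]
  have e4 : √(π/2) = √π*√2/2 := by
    rw [Real.sqrt_div hpi.le, div_eq_div_iff (by positivity) (by norm_num), mul_assoc, Real.mul_self_sqrt (by norm_num)]
  rw [e1, e2, e3, e4, Real.sqrt_mul hpi.le]
  unfold PP
  have h2 : √2^2 = 2 := Real.sq_sqrt (by norm_num)
  have hp2 : √π^2 = π := Real.sq_sqrt hpi.le
  have hn2 : √n^2 = n := Real.sq_sqrt hn.le
  have h20 : 0 < √2 := by positivity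
  have hp0 : 0 < √π := by positivity
  have hn0 : 0 < √n := by positivity
  generalize √2 = b at *
  generalize √n = c at *
  generalize hP : √π = e at *
  subst hn2
  rw [← hp2]
  field_simp
  ring

theorem expHeight_final :
    ∃ C > (0 : ℝ), ∃ N₀ : ℕ, ∀ n : ℕ, N₀ ≤ n →
      |expHeight n -
          (2 * catalanG * Real.sqrt (2 * n / π) - 1 +
            5 * Real.sqrt 2 * catalanG / (6 * Real.sqrt (π * n)) -
            131 * Real.sqrt 2 * catalanG / (720 * Real.sqrt (π * (n : ℝ) ^ 3)) +
            1129 * Real.sqrt 2 * catalanG / (12096 * Real.sqrt (π * (n : ℝ) ^ 5)))| ≤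
        C * (n : ℝ) ^ (-(7 : ℝ) / 2) := by
  obtain ⟨C0, hC0, K, hb⟩ := binom_approx
  obtain ⟨B0, hB0, hX0⟩ := X_asymp 0 (by norm_num) C0 hC0 K
  obtain ⟨B1, hB1, hX1⟩ := X_asymp 1 (by norm_num) C0 hC0 K
  obtain ⟨C2, hC2, hre⟩ := ratio_expand
  have hpi := Real.pi_pos
  set g := catalanG * √(π/2) with hg
  obtain ⟨N, hN⟩ := exists_nat_gt (16 * B0)
  refine ⟨(π*B1 + 4 * |g| * B0) / (π/16*(π/8)) + |4*g/π| * C2, by positivity, max 15 N, fun n hn => ?_⟩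
  have hn15 : 15 ≤ n := (le_max_left _ _).trans hn
  have hnN : (N:ℝ) ≤ n := by exact_mod_cast (le_max_right _ _).trans hn
  have hn15' : (15:ℝ) ≤ n := by exact_mod_cast hn15
  have hn0 : (0:ℝ) < n := by linarith
  obtain ⟨κ, hκ, hyp⟩ := hb (n+1) (by omega)
  obtain ⟨p, hp, hpar⟩ : ∃ p : ℕ, (p = 1 ∨ p = 2) ∧ (n+1+p)%2 = 0 := by
    rcases Nat.even_or_odd n with h | h
    · exact ⟨1, Or.inl rfl, by obtain ⟨k, hk⟩ := h; omega⟩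
    · exact ⟨2, Or.inr rfl, by obtain ⟨k, hk⟩ := h; omega⟩
  have a0 := hX0 (n+1) κ hκ hyp p hp hpar
  have a1 := hX1 (n+1) κ hκ hyp p hp hpar
  rw [X_eq_V _ n p κ (by omega) hp hpar] at a0 a1
  rw [dd_eq, show 1+0 = 1 from rfl, moment_1] at a0
  rw [nn_eq, show 1+1 = 2 from rfl, moment_2, ← hg] at a1
  have hcast : ((n+1:ℕ):ℝ)+1 = n+2 := by push_cast; ring
  rw [hcast] at a0 a1
  set t : ℝ := 1/n with ht
  have ht0 : 0 < t := by positivity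
  have ht1 : t ≤ 1/2 := by rw [ht]; apply one_div_le_one_div_of_le <;> linarith
  have hat : 1/((n:ℝ)+2) = t/(1+2*t) := by rw [ht]; field_simp
  set a : ℝ := 1/((n:ℝ)+2) with ha
  have ha0 : 0 < a := by positivity
  have hle : a ≤ t := by rw [ha, ht]; apply one_div_le_one_div_of_le <;> linarith
  have ha1 : a ≤ 1/2 := hle.trans ht1
  set ε := √a with hε
  have hε0 : 0 < ε := Real.sqrt_pos.2 ha0
  have hε1 : ε ≤ 1 := Real.sqrt_le_one.2 (by linarith)
  obtain ⟨hd1, hd2⟩ := dd_bd a ha0.le ha1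
  obtain ⟨hn1, hn2⟩ := nn_bd a ha0.le ha1
  have hsm : 2*ε*(B0*a^4) ≤ π/16 := by
    have h1 : a^4 ≤ a := by
      calc a^4 = a * a^3 := by ring
        _ ≤ a * 1 := by gcongr; exact pow_le_one₀ ha0.le (by linarith)
        _ = a := mul_one _
    have h2 : B0 * a ≤ 1/16 := by
      rw [ha, mul_one_div, div_le_iff₀ (by positivity)]; linarith
    have h3 : B0 * a^4 ≤ 1/16 := (mul_le_mul_of_nonneg_left h1 hB0.le).trans h2
    have h4 : 0 ≤ B0 * a^4 := by positivity
    nlinarith [Real.pi_gt_three]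
  set W0 := ∑' h : ℕ, ((h:ℝ)+1)^0 * (V n h : ℝ) with hW0
  set W1 := ∑' h : ℕ, ((h:ℝ)+1)^1 * (V n h : ℝ) with hW1
  obtain ⟨hpos, hrat⟩ := ratio_lemma ε (nn a) (dd a) g _ _ _ _ (B0*a^4) (B1*a^4) hε0 hd1 hd2 hn1 hn2
    (by ring : ε^(0+1) * (((n:ℝ)+1)/(2*κ)) * W0 = 1/(2*ε) * (dd a * (π/4)) + (ε^(0+1) * (((n:ℝ)+1)/(2*κ)) * W0 - 1/(2*ε) * (dd a * (π/4))))
    (by ring : ε^(1+1) * (((n:ℝ)+1)/(2*κ)) * W1 = 1/(2*ε) * (nn a * g) + (ε^(1+1) * (((n:ℝ)+1)/(2*κ)) * W1 - 1/(2*ε) * (nn a * g)))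
    a0 a1 hsm
  have hW0p : 0 < W0 := pos_of_mul_pos_right hpos (by positivity)
  have hE : expHeight n = W1/W0 - 1 := by
    have s1 : Summable (fun h : ℕ => (h:ℝ) * (V n h : ℝ)) := VV_summable n (by omega) _
    have s2 : Summable (fun h : ℕ => (V n h : ℝ)) := by simpa using VV_summable n (by omega) (fun _ => 1)
    have w0 : W0 = ∑' h : ℕ, (V n h : ℝ) := by rw [hW0]; simp
    have w1 : W1 = ∑' h : ℕ, (h:ℝ) * (V n h : ℝ) + W0 := by
      rw [w0, ← s1.tsum_add s2, hW1]
      congr 1; ext h; ring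
    rw [expHeight, ← w0, w1]
    field_simp
    ring
  have hq : ε^(1+1) * (((n:ℝ)+1)/(2*κ)) * W1 / (ε * (ε^(0+1) * (((n:ℝ)+1)/(2*κ)) * W0)) = W1/W0 := by
    have : (0:ℝ) < (n:ℝ)+1 := by positivity
    field_simp
    ring
  rw [hq] at hrat
  rw [target_eq _ hn0, ← hg, hE]
  have hinv : 1/ε = √n * √(1+2*t) := by
    rw [← Real.sqrt_mul hn0.le, hε, one_div, ← Real.sqrt_inv]
    congr 1
    rw [ha, ht]; field_simp
  have hre' := hre t ht0 ht1
  rw [← hat] at hre'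
  have hpow : (n:ℝ)^(-(7:ℝ)/2) = √n * t^4 := by
    have e4 : t^4 = (n:ℝ)^(-(4:ℝ)) := by
      rw [Real.rpow_neg hn0.le, ht, one_div_pow, one_div]
      norm_cast
    rw [e4, Real.sqrt_eq_rpow, ← Real.rpow_add hn0]
    norm_num
  have hsn : 1 ≤ √(n:ℝ) := Real.one_le_sqrt.2 (by linarith)
  rw [hpow]
  have hsplit : W1/W0 - 1 - (4*g/π * √n * PP (1/n) - 1) = (W1/W0 - 4*g/π/ε * (nn a/dd a)) + 4*g/π * √n * (√(1+2*t) * (nn a/dd a) - PP t) := by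
    rw [show 4*g/π/ε * (nn a/dd a) = 4*g/π*(1/ε) * (nn a/dd a) by ring, hinv, ← ht]
    ring
  rw [hsplit, add_mul]
  refine (abs_add_le _ _).trans (add_le_add ?_ ?_)
  · refine hrat.trans ?_
    have : a^4 ≤ √n * t^4 := by
      calc a^4 ≤ t^4 := by gcongr
        _ = 1 * t^4 := (one_mul _).symm
        _ ≤ _ := by gcongr
    calc (π*(B1*a^4) + 4 * |g| * (B0*a^4)) / (π/16*(π/8)) = (π*B1 + 4 * |g| * B0) / (π/16*(π/8)) * a^4 := by ring
      _ ≤ _ := by gcongr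
  · rw [abs_mul, abs_mul, abs_of_pos (by positivity : 0 < √(n:ℝ))]
    calc |4*g/π| * √n * |√(1+2*t) * (nn a/dd a) - PP t| ≤ |4*g/π| * √n * (C2 * t^4) := by gcongr
      _ = _ := by ring
end Part10

/-- Asymptotic expansion of the expected height of admissible walks on `ℕ₀`:
`E H_n = 2G√(2n/π) − 1 + 5√2 G/(6√(πn)) − 131√2 G/(720√(πn³)) + 1129√2 G/(12096√(πn⁵))
 + O(n^{−7/2})`. -/
theorem expHeight_asymptotics :
    ∃ C > (0 : ℝ), ∃ N₀ : ℕ, ∀ n : ℕ, N₀ ≤ n →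
      |expHeight n -
          (2 * catalanG * Real.sqrt (2 * n / π) - 1 +
            5 * Real.sqrt 2 * catalanG / (6 * Real.sqrt (π * n)) -
            131 * Real.sqrt 2 * catalanG / (720 * Real.sqrt (π * (n : ℝ) ^ 3)) +
            1129 * Real.sqrt 2 * catalanG / (12096 * Real.sqrt (π * (n : ℝ) ^ 5)))| ≤
        C * (n : ℝ) ^ (-(7 : ℝ) / 2) :=
  expHeight_final
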